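/- arXiv:2311.03013 — 2 statements merged into one kernel-verified Lean document; each statement's English description precedes it below -/
import Mathlib

section
/- Let S ∈ L¹_loc[0,∞) be log-linearly slowly decreasing, with Laplace transform 𝓛{S;s} = ∫₀^∞ e^{−sx} S(x) dx convergent for every complex s with Re s > 1, and set U(s) = Re 𝓛{S;s}. Assume U has L¹_loc-boundary behavior on 1 + i(ℝ∖{0}), and assume there exist λ > 0, g ∈ L¹(−λ,λ), k ∈ ℕ and C > 0 such that U(σ+it) ≥ g(t) for a.e. t ∈ (−λ,λ) and all σ ∈ (1,2], and |U(σ+it)| ≤ C(σ−1)^{−k} for all t ∈ (−λ,λ) and σ ∈ (1,2]. Then the limit a = lim_{σ→1⁺} (σ−1) U(σ) exists and S(x) ∼ a e^x as x → ∞, i.e. lim_{x→∞} e^{−x} S(x) = a. -/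
open MeasureTheory Filter Set

/-- The Laplace transform `𝓛{S;s} = ∫₀^∞ e^{-sx} S(x) dx`. -/
noncomputable def laplaceT (S : ℝ → ℝ) (s : ℂ) : ℂ :=
  ∫ x in Ioi (0 : ℝ), Complex.exp (-s * x) * (S x : ℂ)

/-- `S` is log-linearly slowly decreasing. -/
def LogLinSlowlyDecreasing (S : ℝ → ℝ) : Prop :=
  ∀ ε : ℝ, 0 < ε → ∃ h : ℝ, 0 < h ∧ ∃ x₀ : ℝ, 0 < x₀ ∧ ∀ x y : ℝ,
    x₀ ≤ x → x ≤ y → y ≤ x + h → (S y - S x) / Real.exp x ≥ -ε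

/-- `U` (defined on `Re s > 1`) has `L¹_loc`-boundary behavior on `1 + i(ℝ∖{0})`. -/
def L1locBoundaryBehavior (U : ℂ → ℝ) : Prop :=
  ∃ f : ℝ → ℝ, ∀ a b : ℝ, a ≤ b → (0 : ℝ) ∉ Icc a b →
    IntegrableOn f (Icc a b) ∧
    Tendsto (fun σ : ℝ => ∫ t in a..b, |U (σ + t * Complex.I) - f t|)
      (nhdsWithin 1 (Ioi 1)) (nhds 0)

theorem wi_lap_int (W : ℝ → ℝ)
    (hW : ∀ σ : ℝ, 1 < σ → IntegrableOn (fun x => Real.exp (-σ * x) * W x) (Ioi 0))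
    (σ : ℝ) (hσ : 1 < σ) :
    IntegrableOn (fun x => Real.exp (-σ * x) * (x * W x)) (Ioi 0) := by
  set δ := (σ - 1) / 2 with hδ
  have hδ0 : 0 < δ := by rw [hδ]; linarith
  have h1 := hW (1 + δ) (by linarith)
  have h2 : IntegrableOn (fun x => (x * Real.exp (-δ * x)) * (Real.exp (-(1 + δ) * x) * W x)) (Ioi 0) := by
    refine Integrable.bdd_mul (c := 1 / δ) h1 (by fun_prop) ?_
    filter_upwards [ae_restrict_mem measurableSet_Ioi] with x hx
    have hx : 0 < x := hx
    rw [Real.norm_eq_abs, abs_of_pos (by positivity), le_div_iff₀ hδ0]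
    have := Real.add_one_le_exp (δ * x)
    rw [neg_mul, Real.exp_neg]
    have h3 := Real.exp_pos (δ * x)
    field_simp
    rw [mul_comm x δ]
    linarith
  refine h2.congr_fun ?_ measurableSet_Ioi
  intro x _
  simp only
  have : Real.exp (-σ * x) = Real.exp (-δ * x) * Real.exp (-(1 + δ) * x) := by
    rw [← Real.exp_add]; congr 1; rw [hδ]; ring
  rw [this]; ring

theorem wi_lap_deriv (W : ℝ → ℝ)
    (hW : ∀ σ : ℝ, 1 < σ → IntegrableOn (fun x => Real.exp (-σ * x) * W x) (Ioi 0))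
    (σ : ℝ) (hσ : 1 < σ) :
    HasDerivAt (fun σ : ℝ => ∫ x in Ioi (0:ℝ), Real.exp (-σ * x) * W x)
      (-(∫ x in Ioi (0:ℝ), Real.exp (-σ * x) * (x * W x))) σ := by
  set τ := (σ + 1) / 2 with hτ
  have hτ1 : 1 < τ := by rw [hτ]; linarith
  have hτ2 : τ < σ := by rw [hτ]; linarith
  have hb := (wi_lap_int W hW τ hτ1).norm
  rw [← integral_neg]
  refine (hasDerivAt_integral_of_dominated_loc_of_deriv_le (s := Ioi τ) (Ioi_mem_nhds hτ2)
    (F := fun σ x => Real.exp (-σ * x) * W x)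
    (F' := fun σ x => -(Real.exp (-σ * x) * (x * W x)))
    (bound := fun x => ‖Real.exp (-τ * x) * (x * W x)‖) ?_ (hW σ hσ)
    (wi_lap_int W hW σ hσ).neg.aestronglyMeasurable ?_ hb ?_).2
  · filter_upwards [Ioi_mem_nhds hσ] with s hs
    exact (hW s hs).aestronglyMeasurable
  · filter_upwards [ae_restrict_mem measurableSet_Ioi] with x hx s hs
    have hx : 0 < x := hx
    have hs : τ < s := hs
    rw [norm_neg, norm_mul, norm_mul (Real.exp (-τ * x))]
    gcongr
    rw [Real.norm_eq_abs, Real.norm_eq_abs, Real.abs_exp, Real.abs_exp]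
    apply Real.exp_le_exp.2
    nlinarith
  · filter_upwards with x s hs
    have h1 : HasDerivAt (fun s : ℝ => -s * x) (-1 * x) s := (hasDerivAt_id s).neg.mul_const x
    exact ((h1.exp).mul_const (W x)).congr_deriv (by ring)

theorem wi_sub_bound (G H : ℝ → ℝ) (hG : ∀ σ : ℝ, 1 < σ → HasDerivAt G (H σ) σ)
    (Z Z' : ℝ → ℝ) (hZ : ∀ σ : ℝ, 1 < σ → HasDerivAt Z (Z' σ) σ)
    (C : ℝ) (hH : ∀ σ ∈ Ioc (1:ℝ) 2, |H σ| ≤ C * Z' σ) :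
    MonotoneOn (fun σ => C * Z σ + G σ) (Ioc 1 2) ∧
    MonotoneOn (fun σ => C * Z σ - G σ) (Ioc 1 2) := by
  have key : ∀ (s : ℝ), (s = 1 ∨ s = -1) → MonotoneOn (fun σ => C * Z σ + s * G σ) (Ioc 1 2) := by
    intro s hs
    have hd : ∀ σ : ℝ, 1 < σ → HasDerivAt (fun σ => C * Z σ + s * G σ) (C * Z' σ + s * H σ) σ :=
      fun σ h => ((hZ σ h).const_mul C).add ((hG σ h).const_mul s)
    apply monotoneOn_of_deriv_nonneg (convex_Ioc 1 2)
    · intro σ hσ; exact (hd σ hσ.1).continuousAt.continuousWithinAt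
    · rw [interior_Ioc]; intro σ hσ; exact (hd σ hσ.1).differentiableAt.differentiableWithinAt
    · rw [interior_Ioc]; intro σ hσ
      rw [(hd σ hσ.1).deriv]
      have := abs_le.1 (hH σ ⟨hσ.1, hσ.2.le⟩)
      rcases hs with rfl | rfl <;> linarith [this.1, this.2]
  refine ⟨?_, ?_⟩
  · simpa using key 1 (Or.inl rfl)
  · simpa [sub_eq_add_neg] using key (-1) (Or.inr rfl)

theorem wi_step_pos (G H : ℝ → ℝ) (hG : ∀ σ : ℝ, 1 < σ → HasDerivAt G (H σ) σ)
    (q C : ℝ) (hq : 0 < q) (hH : ∀ σ ∈ Ioc (1:ℝ) 2, |H σ| ≤ C * (σ - 1) ^ (-(q + 1))) :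
    ∃ C', ∀ σ ∈ Ioc (1:ℝ) 2, |G σ| ≤ C' * (σ - 1) ^ (-q) := by
  have hZ : ∀ σ : ℝ, 1 < σ → HasDerivAt (fun σ : ℝ => -((σ - 1) ^ (-q) / q)) ((σ - 1) ^ (-(q+1))) σ := by
    intro σ hσ
    have h1 : HasDerivAt (fun σ : ℝ => σ - 1) 1 σ := (hasDerivAt_id σ).sub_const 1
    refine ((h1.rpow_const (p := -q) (Or.inl (by linarith))).div_const q).neg.congr_deriv ?_
    rw [show -(q+1) = -q - 1 by ring]
    field_simp
  obtain ⟨m1, m2⟩ := wi_sub_bound G H hG _ _ hZ C hH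
  have hC : 0 ≤ C := by
    have := (abs_nonneg _).trans (hH 2 (by norm_num))
    norm_num at this; exact this
  refine ⟨C / q + |G 2|, fun σ hσ => ?_⟩
  have a1 := m1 hσ (by norm_num : (2:ℝ) ∈ Ioc (1:ℝ) 2) hσ.2
  have a2 := m2 hσ (by norm_num : (2:ℝ) ∈ Ioc (1:ℝ) 2) hσ.2
  simp only at a1 a2
  norm_num at a1 a2
  have h1 : 1 ≤ (σ - 1) ^ (-q) := by
    apply Real.one_le_rpow_of_pos_of_le_one_of_nonpos <;> linarith [hσ.1, hσ.2]
  have h2 : |G 2| ≤ |G 2| * (σ - 1) ^ (-q) := le_mul_of_one_le_right (abs_nonneg _) h1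
  have h3 : C * ((σ - 1) ^ (-q) / q) = C / q * (σ - 1) ^ (-q) := by ring
  have h4 : 0 ≤ C * q⁻¹ := by positivity
  rw [abs_le]
  have := abs_le.1 (le_refl |G 2|)
  constructor <;> nlinarith

theorem wi_step_zero (G H : ℝ → ℝ) (hG : ∀ σ : ℝ, 1 < σ → HasDerivAt G (H σ) σ)
    (C : ℝ) (hH : ∀ σ ∈ Ioc (1:ℝ) 2, |H σ| ≤ C * (σ - 1) ^ (-(1/2:ℝ))) :
    ∃ m, Tendsto G (nhdsWithin 1 (Ioi 1)) (nhds m) ∧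
     ∃ C', ∀ σ ∈ Ioc (1:ℝ) 2, |G σ| ≤ C' := by
  have hZ : ∀ σ : ℝ, 1 < σ → HasDerivAt (fun σ : ℝ => 2 * ((σ - 1) ^ (1/2:ℝ))) ((σ - 1) ^ (-(1/2:ℝ))) σ := by
    intro σ hσ
    have h1 : HasDerivAt (fun σ : ℝ => σ - 1) 1 σ := (hasDerivAt_id σ).sub_const 1
    refine ((h1.rpow_const (p := (1/2:ℝ)) (Or.inl (by linarith))).const_mul 2).congr_deriv ?_
    rw [show -(1/2:ℝ) = 1/2 - 1 by norm_num]
    ring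
  obtain ⟨m1, m2⟩ := wi_sub_bound G H hG _ _ hZ C hH
  have hC : 0 ≤ C := by
    have := (abs_nonneg _).trans (hH 2 (by norm_num))
    norm_num at this; exact this
  have hb : ∀ σ ∈ Ioc (1:ℝ) 2, |G σ| ≤ 2 * C + |G 2| := by
    intro σ hσ
    have a1 := m1 hσ (by norm_num : (2:ℝ) ∈ Ioc (1:ℝ) 2) hσ.2
    have a2 := m2 hσ (by norm_num : (2:ℝ) ∈ Ioc (1:ℝ) 2) hσ.2
    simp only at a1 a2
    norm_num at a1 a2
    have h1 : 0 ≤ C * (2 * (σ - 1) ^ (1/2:ℝ)) := by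
      have : 0 ≤ (σ - 1) ^ (1/2:ℝ) := Real.rpow_nonneg (by linarith [hσ.1]) _
      positivity
    have := abs_le.1 (le_refl |G 2|)
    rw [abs_le]
    constructor <;> linarith
  have hm : MonotoneOn (fun σ : ℝ => C * (2 * (σ - 1) ^ (1/2:ℝ)) + G σ) (Ioo 1 2) :=
    m1.mono Ioo_subset_Ioc_self
  have hbb : BddBelow ((fun σ : ℝ => C * (2 * (σ - 1) ^ (1/2:ℝ)) + G σ) '' (Ioo 1 2)) := by
    refine ⟨-(2 * C + |G 2|), ?_⟩
    rintro _ ⟨σ, hσ, rfl⟩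
    have h1 : 0 ≤ C * (2 * (σ - 1) ^ (1/2:ℝ)) := by
      have : 0 ≤ (σ - 1) ^ (1/2:ℝ) := Real.rpow_nonneg (by linarith [hσ.1]) _
      positivity
    have := (abs_le.1 (hb σ ⟨hσ.1, hσ.2.le⟩)).1
    simp only; linarith
  have ht := hm.tendsto_nhdsWithin_Ioo_right (by simp) hbb
  have hz : Tendsto (fun σ : ℝ => C * (2 * (σ - 1) ^ (1/2:ℝ))) (nhdsWithin 1 (Ioi 1)) (nhds 0) := by
    have : ContinuousAt (fun σ : ℝ => C * (2 * (σ - 1) ^ (1/2:ℝ))) 1 := by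
      have : ContinuousAt (fun σ : ℝ => (σ - 1) ^ (1/2:ℝ)) 1 :=
        ContinuousAt.rpow_const (by fun_prop) (Or.inr (by norm_num))
      fun_prop
    have h := this.tendsto
    norm_num at h
    norm_num
    exact h.mono_left nhdsWithin_le_nhds
  have h5 := ht.sub hz
  simp only [add_sub_cancel_left, sub_zero] at h5
  exact ⟨_, h5, _, hb⟩

/-- descending chain -/
theorem wi_chain (A : ℕ → ℝ → ℝ)
    (hA : ∀ n, ∀ σ : ℝ, 1 < σ → HasDerivAt (A n) (-(A (n+1) σ)) σ)
    (N k : ℕ) (hN : k + 1 ≤ N) (C : ℝ)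
    (hb : ∀ σ ∈ Ioc (1:ℝ) 2, |A N σ| ≤ C * (σ - 1) ^ (-((k:ℝ) + 1/2))) :
    ∃ m, Tendsto (A 0) (nhdsWithin 1 (Ioi 1)) (nhds m) := by
  have key : ∀ i, i ≤ N → ∃ C, ∀ σ ∈ Ioc (1:ℝ) 2,
      |A (N - i) σ| ≤ C * (σ - 1) ^ (-(((k - i : ℕ):ℝ) + 1/2)) := by
    intro i
    induction i with
    | zero => intro _; exact ⟨C, by simpa using hb⟩
    | succ i ih =>
      intro hi
      obtain ⟨C1, h1⟩ := ih (by omega)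
      have hd := hA (N - (i+1))
      rw [show N - (i+1) + 1 = N - i by omega] at hd
      rcases Nat.eq_zero_or_pos (k - i) with h0 | h0
      · rw [h0] at h1
        obtain ⟨m, _, C2, h2⟩ := wi_step_zero _ _ hd C1 (by
          intro σ hσ; rw [abs_neg]; simpa using h1 σ hσ)
        refine ⟨C2, fun σ hσ => (h2 σ hσ).trans ?_⟩
        rw [show k - (i+1) = 0 by omega]
        have hC2 : 0 ≤ C2 := (abs_nonneg _).trans (h2 σ hσ)
        apply le_mul_of_one_le_right hC2
        apply Real.one_le_rpow_of_pos_of_le_one_of_nonpos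
        · linarith [hσ.1]
        · linarith [hσ.2]
        · norm_num
      · apply wi_step_pos _ _ hd _ C1 (by positivity)
        intro σ hσ
        rw [abs_neg]
        convert h1 σ hσ using 3
        rw [show k - i = (k - (i+1)) + 1 by omega]
        push_cast; ring
  obtain ⟨C1, h1⟩ := key (N - 1) (by omega)
  rw [show N - (N-1) = 1 by omega, show k - (N-1) = 0 by omega] at h1
  obtain ⟨m, hm, _⟩ := wi_step_zero _ _ (hA 0) C1 (by
    intro σ hσ; rw [abs_neg]; simpa using h1 σ hσ)
  exact ⟨m, hm⟩

theorem wi_fubini (μ ν : Measure ℝ) [SFinite μ] [SFinite ν] (w χ : ℝ → ℝ)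
    (hw : Integrable w μ) (hχ : Integrable χ ν) :
    ∫ t, (∫ x, w x * Real.cos (t * x) ∂μ) * χ t ∂ν
      = ∫ x, w x * (∫ t, χ t * Real.cos (t * x) ∂ν) ∂μ := by
  simp_rw [← integral_mul_const, ← integral_const_mul]
  rw [integral_integral_swap]
  · congr 1; ext x; congr 1; ext t; ring
  · have h := hχ.mul_prod hw
    have h2 : Integrable (fun z : ℝ × ℝ => Real.cos (z.1 * z.2) * (χ z.1 * w z.2)) (ν.prod μ) := by
      refine Integrable.bdd_mul (c := 1) h (by fun_prop) ?_
      filter_upwards with z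
      exact Real.abs_cos_le_one _
    refine h2.congr ?_
    filter_upwards with z
    simp [Function.uncurry]
    ring

theorem wi_parts (χ : ℝ → ℝ) (h : ContDiff ℝ (⊤ : ℕ∞) χ) (hc : HasCompactSupport χ) (x : ℝ) :
    ∫ t, deriv (deriv χ) t * Real.cos (t * x) = - (x ^ 2 * ∫ t, χ t * Real.cos (t * x)) := by
  have h1 : ContDiff ℝ (⊤ : ℕ∞) (deriv χ) := by
    exact ((contDiff_infty_iff_deriv.1 h).2)
  have h2 : ContDiff ℝ (⊤ : ℕ∞) (deriv (deriv χ)) := by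
    exact ((contDiff_infty_iff_deriv.1 h1).2)
  have hd0 : ∀ t, HasDerivAt χ (deriv χ t) t := fun t =>
    ((contDiff_infty_iff_deriv.1 h).1 t).hasDerivAt
  have hd1 : ∀ t, HasDerivAt (deriv χ) (deriv (deriv χ) t) t := fun t =>
    ((contDiff_infty_iff_deriv.1 h1).1 t).hasDerivAt
  have hlin : ∀ t : ℝ, HasDerivAt (fun t : ℝ => t * x) x t := fun t => by
    simpa using (hasDerivAt_id t).mul_const x
  have hcos : ∀ t, HasDerivAt (fun t : ℝ => Real.cos (t * x)) (-Real.sin (t * x) * x) t :=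
    fun t => (hlin t).cos
  have hsin : ∀ t, HasDerivAt (fun t : ℝ => Real.sin (t * x)) (Real.cos (t * x) * x) t :=
    fun t => (hlin t).sin
  have int : ∀ p q : ℝ → ℝ, Continuous p → HasCompactSupport p → Continuous q → Integrable (p * q) :=
    fun p q hp hpc hq => (hp.mul hq).integrable_of_hasCompactSupport hpc.mul_right
  have int' : ∀ p q : ℝ → ℝ, Continuous p → HasCompactSupport p → Continuous q → Integrable (q * p) :=
    fun p q hp hpc hq => (hq.mul hp).integrable_of_hasCompactSupport hpc.mul_left
  have e1 := integral_mul_deriv_eq_deriv_mul_of_integrable (u := fun t : ℝ => Real.cos (t * x))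
    (v := deriv χ) (fun t _ => hcos t) (fun t _ => hd1 t)
    (int' _ _ h2.continuous hc.deriv.deriv (by fun_prop))
    (int' _ _ h1.continuous hc.deriv (by fun_prop))
    (int' _ _ h1.continuous hc.deriv (by fun_prop))
  have e2 := integral_mul_deriv_eq_deriv_mul_of_integrable (u := fun t : ℝ => Real.sin (t * x))
    (v := χ) (fun t _ => hsin t) (fun t _ => hd0 t)
    (int' _ _ h1.continuous hc.deriv (by fun_prop))
    (int' _ _ h.continuous hc (by fun_prop))
    (int' _ _ h.continuous hc (by fun_prop))
  have e3 : ∫ t, -Real.sin (t * x) * x * deriv χ t = -x * ∫ t, Real.sin (t * x) * deriv χ t := by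
    rw [← integral_const_mul]; congr 1; ext t; ring
  have e4 : ∫ t, Real.cos (t * x) * x * χ t = x * ∫ t, χ t * Real.cos (t * x) := by
    rw [← integral_const_mul]; congr 1; ext t; ring
  have e5 : ∫ t, deriv (deriv χ) t * Real.cos (t * x) = ∫ t, Real.cos (t * x) * deriv (deriv χ) t := by
    congr 1; ext t; ring
  rw [e5, e1, e3, e2, e4]; ring

theorem wi_test (lam : ℝ) (ψ : ℝ → ℝ) (h : ContDiff ℝ (⊤ : ℕ∞) ψ) (hc : HasCompactSupport ψ)
    (hs : tsupport ψ ⊆ Ioo (-lam) lam) (m : ℕ) :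
    ∃ χ : ℝ → ℝ, ContDiff ℝ (⊤ : ℕ∞) χ ∧ HasCompactSupport χ ∧ tsupport χ ⊆ Ioo (-lam) lam ∧
      ∀ x, ∫ t, χ t * Real.cos (t * x) = (-1) ^ m * x ^ (2 * m) * ∫ t, ψ t * Real.cos (t * x) := by
  induction m with
  | zero => exact ⟨ψ, h, hc, hs, fun x => by simp⟩
  | succ m ih =>
    obtain ⟨χ, h1, h2, h3, h4⟩ := ih
    refine ⟨deriv (deriv χ), ?_, h2.deriv.deriv, ?_, ?_⟩
    · exact (contDiff_infty_iff_deriv.1 (contDiff_infty_iff_deriv.1 h1).2).2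
    · intro t ht
      exact h3 (tsupport_deriv_subset (tsupport_deriv_subset ht))
    · intro x
      rw [wi_parts χ h1 h2, h4]; ring

theorem wi_phi_cont (χ : ℝ → ℝ) (ν : Measure ℝ) (hχ : Integrable χ ν) :
    Continuous (fun x => ∫ t, χ t * Real.cos (t * x) ∂ν) := by
  refine continuous_of_dominated (bound := fun t => ‖χ t‖) ?_ ?_ hχ.norm ?_
  · intro x
    exact hχ.aestronglyMeasurable.mul (by fun_prop)
  · intro x; filter_upwards with t
    rw [norm_mul]
    exact mul_le_of_le_one_right (norm_nonneg _) (Real.abs_cos_le_one _)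
  · filter_upwards with t; fun_prop

theorem wi_phi_bdd (χ : ℝ → ℝ) (ν : Measure ℝ) (hχ : Integrable χ ν) (x : ℝ) :
    ‖∫ t, χ t * Real.cos (t * x) ∂ν‖ ≤ ∫ t, ‖χ t‖ ∂ν := by
  refine norm_integral_le_of_norm_le hχ.norm ?_
  filter_upwards with t
  rw [norm_mul]
  exact mul_le_of_le_one_right (norm_nonneg _) (Real.abs_cos_le_one _)

theorem wi_Fconv (S : ℝ → ℝ)
    (hI : ∀ σ : ℝ, 1 < σ → IntegrableOn (fun x => Real.exp (-σ * x) * S x) (Ioi 0))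
    (lam : ℝ) (k : ℕ) (C : ℝ) (hC : 0 < C)
    (hgrow : ∀ t ∈ Ioo (-lam) lam, ∀ σ ∈ Ioc (1 : ℝ) 2,
      |∫ x in Ioi (0:ℝ), Real.exp (-σ * x) * S x * Real.cos (t * x)| ≤ C / (σ - 1) ^ k)
    (ψ : ℝ → ℝ) (h : ContDiff ℝ (⊤ : ℕ∞) ψ) (hc : HasCompactSupport ψ)
    (hs : tsupport ψ ⊆ Ioo (-lam) lam) :
    ∃ m, Tendsto (fun σ : ℝ => ∫ t,
      (∫ x in Ioi (0:ℝ), Real.exp (-σ * x) * S x * Real.cos (t * x)) * ψ t)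
      (nhdsWithin 1 (Ioi 1)) (nhds m) := by
  set Φ : ℝ → ℝ := fun x => ∫ t, ψ t * Real.cos (t * x) with hΦ
  have hψi : Integrable ψ := h.continuous.integrable_of_hasCompactSupport hc
  have hΦc : Continuous Φ := wi_phi_cont ψ volume hψi
  have hW : ∀ n : ℕ, ∀ σ : ℝ, 1 < σ →
      IntegrableOn (fun x => Real.exp (-σ * x) * (x ^ n * (S x * Φ x))) (Ioi 0) := by
    intro n
    induction n with
    | zero =>
      intro σ hσ
      have : IntegrableOn (fun x => Φ x * (Real.exp (-σ * x) * S x)) (Ioi 0) := by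
        refine Integrable.bdd_mul (c := ∫ t, ‖ψ t‖) (hI σ hσ) hΦc.aestronglyMeasurable ?_
        filter_upwards with x
        exact wi_phi_bdd ψ volume hψi x
      refine this.congr_fun (fun x _ => ?_) measurableSet_Ioi
      simp only; ring
    | succ n ih =>
      intro σ hσ
      refine (wi_lap_int _ ih σ hσ).congr_fun (fun x _ => ?_) measurableSet_Ioi
      simp only; ring
  set A : ℕ → ℝ → ℝ := fun n σ => ∫ x in Ioi (0:ℝ), Real.exp (-σ * x) * (x ^ n * (S x * Φ x)) with hA
  have hAd : ∀ n, ∀ σ : ℝ, 1 < σ → HasDerivAt (A n) (-(A (n+1) σ)) σ := by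
    intro n σ hσ
    have := wi_lap_deriv _ (hW n) σ hσ
    refine this.congr_deriv ?_
    rw [hA]; simp only; congr 2; ext x; ring
  obtain ⟨χ, hχ1, hχ2, hχ3, hχ4⟩ := wi_test lam ψ h hc hs (k + 1)
  have hχi : Integrable χ := hχ1.continuous.integrable_of_hasCompactSupport hχ2
  have hAN : ∀ σ ∈ Ioc (1:ℝ) 2, |A (2 * (k+1)) σ| ≤ (C * ∫ t, ‖χ t‖) * (σ - 1) ^ (-((k:ℝ) + 1/2)) := by
    intro σ hσ
    have hf := wi_fubini (volume.restrict (Ioi 0)) volume _ χ (hI σ hσ.1) hχi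
    have e1 : |A (2 * (k+1)) σ| =
        |∫ t, (∫ x in Ioi (0:ℝ), Real.exp (-σ * x) * S x * Real.cos (t * x)) * χ t| := by
      rw [hf]
      simp_rw [hχ4]
      rw [show (∫ x in Ioi (0:ℝ), Real.exp (-σ * x) * S x * ((-1) ^ (k + 1) * x ^ (2 * (k + 1)) *
        ∫ t, ψ t * Real.cos (t * x))) = (-1) ^ (k+1) * A (2 * (k+1)) σ from ?_]
      · rw [abs_mul, abs_pow]; simp
      · rw [hA]; simp only; rw [← integral_const_mul]; congr 1; ext x; ring
    have hpos : 0 < σ - 1 := by linarith [hσ.1]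
    rw [e1]
    have e2 : |∫ t, (∫ x in Ioi (0:ℝ), Real.exp (-σ * x) * S x * Real.cos (t * x)) * χ t| ≤
        ∫ t, C / (σ - 1) ^ k * ‖χ t‖ := by
      rw [← Real.norm_eq_abs]
      refine norm_integral_le_of_norm_le (hχi.norm.const_mul _) ?_
      filter_upwards with t
      by_cases ht : t ∈ Ioo (-lam) lam
      · rw [norm_mul]
        exact mul_le_mul_of_nonneg_right (hgrow t ht σ hσ) (norm_nonneg _)
      · rw [image_eq_zero_of_notMem_tsupport (fun h => ht (hχ3 h))]
        simp
    refine e2.trans ?_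
    rw [integral_const_mul]
    have e3 : C / (σ - 1) ^ k ≤ C * (σ - 1) ^ (-((k:ℝ) + 1/2)) := by
      rw [div_eq_mul_inv]
      gcongr
      rw [← Real.rpow_natCast, ← Real.rpow_neg hpos.le]
      apply Real.rpow_le_rpow_of_exponent_ge hpos (by linarith [hσ.2]) (by linarith)
    have e4 : 0 ≤ ∫ t, ‖χ t‖ := integral_nonneg (fun t => norm_nonneg _)
    nlinarith [mul_le_mul_of_nonneg_right e3 e4]
  obtain ⟨m, hm⟩ := wi_chain A hAd _ k (by omega) _ hAN
  refine ⟨m, hm.congr' ?_⟩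
  filter_upwards [self_mem_nhdsWithin] with σ hσ
  rw [wi_fubini (volume.restrict (Ioi 0)) volume _ ψ (hI σ hσ) hψi]
  rw [hA]; simp only; congr 1; ext x; simp only [hΦ]; ring

theorem wi_bound (v g ψ : ℝ → ℝ) (lam δ : ℝ) (hδ : δ < lam)
    (hv : Continuous v) (hψ : Continuous ψ) (hψ0 : ∀ t, 0 ≤ ψ t) (hψ1 : ∀ t, ψ t ≤ 1)
    (hψδ : ∀ t, |t| ≤ δ → ψ t = 1) (hψs : ∀ t, t ∉ Ioo (-lam) lam → ψ t = 0)
    (hg : IntegrableOn g (Ioo (-lam) lam))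
    (hlow : ∀ᵐ t ∂(volume.restrict (Ioo (-lam) lam)), g t ≤ v t) :
    ∫ t in Ioc 0 δ, |v t| ≤ (∫ t, v t * ψ t) + 2 * ∫ t in Ioo (-lam) lam, |g t| := by
  have hsub : Ioc 0 δ ⊆ Ioo (-lam) lam := fun t ht => ⟨by linarith [ht.1, ht.2], by linarith [ht.2]⟩
  have e1 : ∫ t in Ioc 0 δ, |v t| = ∫ t in Ioo (-lam) lam, (Ioc 0 δ).indicator (fun t => |v t|) t := by
    rw [setIntegral_indicator measurableSet_Ioc, inter_eq_self_of_subset_right hsub]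
  have e2 : ∫ t, v t * ψ t = ∫ t in Ioo (-lam) lam, v t * ψ t := by
    rw [setIntegral_eq_integral_of_forall_compl_eq_zero]
    intro t ht; rw [hψs t ht, mul_zero]
  have iv : ∀ p : ℝ → ℝ, Continuous p → IntegrableOn p (Ioo (-lam) lam) := fun p hp =>
    (hp.integrableOn_Icc).mono_set Ioo_subset_Icc_self
  have ivp : IntegrableOn (fun t => v t * ψ t) (Ioo (-lam) lam) := iv _ (hv.mul hψ)
  rw [e1, e2, ← integral_const_mul, ← integral_add ivp (hg.abs.const_mul 2)]
  refine integral_mono_ae ((iv _ hv.abs).indicator measurableSet_Ioc)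
    ((iv _ (hv.mul hψ)).add (hg.abs.const_mul 2)) ?_
  filter_upwards [hlow] with t ht
  have hp0 := hψ0 t
  have hp1 := hψ1 t
  have hga := abs_le.1 (le_refl |g t|)
  by_cases h : t ∈ Ioc 0 δ
  · rw [indicator_of_mem h, hψδ t (by rw [abs_of_pos h.1]; exact h.2), abs_le]
    constructor <;> linarith [hga.1, hga.2]
  · rw [indicator_of_notMem h]
    nlinarith [hga.1, hga.2, abs_nonneg (g t)]

theorem wi_B (u : ℝ → ℝ → ℝ) (hu : ∀ σ : ℝ, 1 < σ → Continuous (u σ))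
    (heven : ∀ σ t : ℝ, u σ (-t) = u σ t)
    (f : ℝ → ℝ)
    (hf : ∀ a b : ℝ, 0 < a → a ≤ b → IntegrableOn f (Icc a b) ∧
      Tendsto (fun σ : ℝ => ∫ t in a..b, |u σ t - f t|) (nhdsWithin 1 (Ioi 1)) (nhds 0))
    (lam δ : ℝ) (hδ0 : 0 < δ) (hδ : δ < lam)
    (g : ℝ → ℝ) (hg : IntegrableOn g (Ioo (-lam) lam))
    (hlow : ∀ σ ∈ Ioc (1 : ℝ) 2, ∀ᵐ t ∂(volume.restrict (Ioo (-lam) lam)), g t ≤ u σ t)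
    (ψ : ℝ → ℝ) (hψ : Continuous ψ) (hψ0 : ∀ t, 0 ≤ ψ t) (hψ1 : ∀ t, ψ t ≤ 1)
    (hψe : ∀ t, ψ (-t) = ψ t)
    (hψδ : ∀ t, |t| ≤ δ → ψ t = 1) (hψs : ∀ t, t ∉ Ioo (-lam) lam → ψ t = 0)
    (m : ℝ) (hm : Tendsto (fun σ : ℝ => ∫ t, u σ t * ψ t) (nhdsWithin 1 (Ioi 1)) (nhds m)) :
    ∃ c, (∀ R, IntegrableOn f (Ioc 0 R)) ∧
      ∀ (h : ℝ → ℝ) (R : ℝ), Continuous h → (∀ t, R ≤ t → h t = 0) →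
      Tendsto (fun σ : ℝ => ∫ t in Ioi (0:ℝ), u σ t * h t) (nhdsWithin 1 (Ioi 1))
        (nhds (c * h 0 + ∫ t in Ioi (0:ℝ), f t * h t)) := by
  have hE : ∀ᶠ σ : ℝ in nhdsWithin 1 (Ioi 1), σ ∈ Ioc (1:ℝ) 2 :=
    Ioc_mem_nhdsGT (by norm_num)
  obtain ⟨B, hB⟩ : ∃ B, ∀ᶠ σ : ℝ in nhdsWithin 1 (Ioi 1), ∫ t in Ioc 0 δ, |u σ t| ≤ B := by
    refine ⟨m + 1 + 2 * ∫ t in Ioo (-lam) lam, |g t|, ?_⟩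
    filter_upwards [hE, hm.eventually (gt_mem_nhds (lt_add_one m))] with σ hσ h2
    have := wi_bound (u σ) g ψ lam δ hδ (hu σ hσ.1) hψ hψ0 hψ1 hψδ hψs hg (hlow σ hσ)
    linarith
  have hB0 : 0 ≤ B := by
    obtain ⟨σ, hσ⟩ := hB.exists
    exact (integral_nonneg (fun t => abs_nonneg _)).trans hσ
  have hfc : ∀ a b : ℝ, 0 < a → IntegrableOn f (Ioc a b) := by
    intro a b ha
    rcases le_or_gt a b with hab | hab
    · exact (hf a b ha hab).1.mono_set Ioc_subset_Icc_self
    · rw [Ioc_eq_empty (by linarith)]; exact integrableOn_empty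
  have uc : ∀ a b σ : ℝ, 1 < σ → IntegrableOn (u σ) (Ioc a b) := fun a b σ hσ =>
    ((hu σ hσ).integrableOn_Icc).mono_set Ioc_subset_Icc_self
  have hfδ : IntegrableOn f (Ioc 0 δ) := by
    have hlim : Tendsto (fun n : ℕ => δ * (1 / ((n:ℝ) + 1))) atTop (nhds 0) := by
      simpa using (tendsto_one_div_add_atTop_nhds_zero_nat (𝕜 := ℝ)).const_mul δ
    have hp : ∀ n : ℕ, 0 < δ * (1 / ((n:ℝ) + 1)) := fun n => by positivity
    have hle : ∀ n : ℕ, δ * (1 / ((n:ℝ) + 1)) ≤ δ := fun n => by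
      apply mul_le_of_le_one_right hδ0.le
      rw [div_le_one (by positivity)]
      have : (0:ℝ) ≤ n := by positivity
      linarith
    refine integrableOn_Ioc_of_intervalIntegral_norm_bounded_left (I := B + 1)
      (fun n => hfc _ _ (hp n)) hlim (Eventually.of_forall fun n => ?_)
    obtain ⟨i1, i2⟩ := hf _ δ (hp n) (hle n)
    obtain ⟨σ, hσ1, hσ2, hσ3⟩ := (hE.and (hB.and (i2.eventually (gt_mem_nhds one_pos)))).exists
    rw [intervalIntegral.integral_of_le (hle n)] at hσ3
    set a := δ * (1 / ((n:ℝ) + 1))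
    have idf : IntegrableOn (fun t => |u σ t - f t|) (Ioc a δ) :=
      ((uc a δ σ hσ1.1).sub (hfc a δ (hp n))).abs
    have s1 : ∫ t in Ioc a δ, ‖f t‖ ≤ ∫ t in Ioc a δ, (|u σ t| + |u σ t - f t|) := by
      refine integral_mono (hfc a δ (hp n)).norm
        ((uc a δ σ hσ1.1).abs.add ((uc a δ σ hσ1.1).sub (hfc a δ (hp n))).abs) fun t => ?_
      rw [Real.norm_eq_abs]
      simp only
      have := abs_sub (u σ t) (u σ t - f t)
      simpa using this
    have s2 : ∫ t in Ioc a δ, |u σ t| ≤ ∫ t in Ioc 0 δ, |u σ t| :=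
      setIntegral_mono_set (uc 0 δ σ hσ1.1).abs (by filter_upwards with t; exact abs_nonneg _)
        (Ioc_subset_Ioc_left (hp n).le).eventuallyLE
    rw [integral_add (uc a δ σ hσ1.1).abs idf] at s1
    linarith
  have hfR : ∀ R, IntegrableOn f (Ioc 0 R) := by
    intro R
    refine (hfδ.union (hfc δ R hδ0)).mono_set ?_
    intro t ht
    rcases le_or_gt t δ with h | h
    · exact Or.inl ⟨ht.1, h⟩
    · exact Or.inr ⟨h, ht.2⟩
  -- integrability of products with continuous compactly supported functions
  have prodint : ∀ (v q : ℝ → ℝ) (R : ℝ), IntegrableOn v (Ioc 0 R) → Continuous q →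
      (∀ t, R ≤ t → q t = 0) → IntegrableOn (fun t => v t * q t) (Ioi 0) := by
    intro v q R hv hq hqR
    obtain ⟨Q, hQ⟩ := (isCompact_Icc (a := (0:ℝ)) (b := R)).exists_bound_of_continuousOn hq.continuousOn
    have h1 : IntegrableOn (fun t => v t * q t) (Ioc 0 R) := by
      refine Integrable.mul_bdd (c := Q) hv hq.aestronglyMeasurable ?_
      filter_upwards [ae_restrict_mem measurableSet_Ioc] with t ht
      exact hQ t ⟨ht.1.le, ht.2⟩
    refine h1.of_forall_sdiff_eq_zero measurableSet_Ioi ?_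
    intro t ht
    have : R ≤ t := by
      by_contra hh
      exact ht.2 ⟨ht.1, (not_le.1 hh).le⟩
    rw [hqR t this, mul_zero]
  have lemA : ∀ (q : ℝ → ℝ) (R : ℝ), Continuous q → q 0 = 0 → (∀ t, R ≤ t → q t = 0) →
      Tendsto (fun σ : ℝ => ∫ t in Ioi (0:ℝ), u σ t * q t) (nhdsWithin 1 (Ioi 1))
        (nhds (∫ t in Ioi (0:ℝ), f t * q t)) := by
    intro q R0 hq hq0 hqR0
    set R := max R0 δ with hR
    have hδR : δ ≤ R := le_max_right _ _
    have hqR : ∀ t, R ≤ t → q t = 0 := fun t ht => hqR0 t ((le_max_left _ _).trans ht)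
    obtain ⟨Q, hQ⟩ := (isCompact_Icc (a := (0:ℝ)) (b := R)).exists_bound_of_continuousOn hq.continuousOn
    have hQ0 : 0 ≤ Q := (norm_nonneg _).trans (hQ 0 ⟨le_refl _, by linarith⟩)
    rw [Metric.tendsto_nhds]
    intro ε hε
    set D := B + ∫ t in Ioc 0 δ, |f t| with hD
    have hD0 : 0 ≤ D := add_nonneg hB0 (integral_nonneg fun t => abs_nonneg _)
    set ε' := ε / (2 * (D + 1)) with hε'
    have hε'0 : 0 < ε' := by positivity
    obtain ⟨η0, hη0, hηq⟩ := Metric.continuousAt_iff.1 hq.continuousAt ε' hε'0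
    set η := min (η0 / 2) δ with hη
    have hηp : 0 < η := by positivity
    have hηδ : η ≤ δ := min_le_right _ _
    have hηq : ∀ t, 0 < t → t ≤ η → |q t| ≤ ε' := by
      intro t h1 h2
      have : dist t 0 < η0 := by
        rw [Real.dist_eq, sub_zero, abs_of_pos h1]
        have := min_le_left (η0 / 2) δ
        linarith
      have := hηq this
      rw [Real.dist_eq, hq0, sub_zero] at this
      exact this.le
    have hlim := (hf η R hηp (hηδ.trans hδR)).2
    have hlim2 := hlim.eventually (gt_mem_nhds (show (0:ℝ) < ε / (2 * (Q + 1)) by positivity))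
    filter_upwards [hE, hB, hlim2] with σ hσ1 hσB hσ3
    rw [intervalIntegral.integral_of_le (hηδ.trans hδR)] at hσ3
    rw [Real.dist_eq, ← integral_sub (prodint _ q R (uc _ _ σ hσ1.1) hq hqR) (prodint _ q R (hfR R) hq hqR)]
    have ud : IntegrableOn (fun t => u σ t - f t) (Ioc 0 R) := (uc 0 R σ hσ1.1).sub (hfR R)
    have e0 : ∫ t in Ioi (0:ℝ), (u σ t * q t - f t * q t) =
        ∫ t in Ioc 0 R, (u σ t - f t) * q t := by
      rw [← setIntegral_eq_of_subset_of_forall_sdiff_eq_zero measurableSet_Ioi (Ioc_subset_Ioi_self)]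
      · congr 1; ext t; ring
      · intro t ht
        have : R ≤ t := by
          by_contra hh
          exact ht.2 ⟨ht.1, (not_le.1 hh).le⟩
        rw [hqR t this]; ring
    have e1 : Ioc 0 R = Ioc 0 η ∪ Ioc η R := (Ioc_union_Ioc_eq_Ioc hηp.le (hηδ.trans hδR)).symm
    have ip : IntegrableOn (fun t => (u σ t - f t) * q t) (Ioc 0 R) := by
      refine Integrable.mul_bdd (c := Q) ud hq.aestronglyMeasurable ?_
      filter_upwards [ae_restrict_mem measurableSet_Ioc] with t ht
      exact hQ t ⟨ht.1.le, ht.2⟩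
    have ip1 := ip.mono_set (Ioc_subset_Ioc_right (hηδ.trans hδR))
    have ip2 := ip.mono_set (Ioc_subset_Ioc_left hηp.le)
    have fδ := hfδ.mono_set (Ioc_subset_Ioc_right hηδ)
    have b1 : |∫ t in Ioc 0 η, (u σ t - f t) * q t| ≤ ε' * D := by
      have s1 : |∫ t in Ioc 0 η, (u σ t - f t) * q t| ≤ ∫ t in Ioc 0 η, ε' * (|u σ t| + |f t|) := by
        rw [← Real.norm_eq_abs]
        refine norm_integral_le_of_norm_le (((uc 0 η σ hσ1.1).abs.add fδ.abs).const_mul _) ?_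
        filter_upwards [ae_restrict_mem measurableSet_Ioc] with t ht
        rw [norm_mul, mul_comm]
        refine mul_le_mul (hηq t ht.1 ht.2) (abs_sub _ _) (norm_nonneg _) hε'0.le
      rw [integral_const_mul, integral_add (uc 0 η σ hσ1.1).abs fδ.abs] at s1
      have s2 : ∫ t in Ioc 0 η, |u σ t| ≤ ∫ t in Ioc 0 δ, |u σ t| :=
        setIntegral_mono_set (uc 0 δ σ hσ1.1).abs (by filter_upwards with t; exact abs_nonneg _)
          (Ioc_subset_Ioc_right hηδ).eventuallyLE
      have s3 : ∫ t in Ioc 0 η, |f t| ≤ ∫ t in Ioc 0 δ, |f t| :=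
        setIntegral_mono_set hfδ.abs (by filter_upwards with t; exact abs_nonneg _)
          (Ioc_subset_Ioc_right hηδ).eventuallyLE
      refine s1.trans ?_
      gcongr
      linarith
    have b2 : |∫ t in Ioc η R, (u σ t - f t) * q t| ≤ Q * ∫ t in Ioc η R, |u σ t - f t| := by
      rw [← Real.norm_eq_abs, ← integral_const_mul]
      refine norm_integral_le_of_norm_le (((ud.mono_set (Ioc_subset_Ioc_left hηp.le)).abs).const_mul _) ?_
      filter_upwards [ae_restrict_mem measurableSet_Ioc] with t ht
      rw [norm_mul, mul_comm]
      exact mul_le_mul_of_nonneg_right (hQ t ⟨hηp.le.trans ht.1.le, ht.2⟩) (norm_nonneg _)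
    rw [e0, e1, setIntegral_union (Ioc_disjoint_Ioc_of_le le_rfl) measurableSet_Ioc ip1 ip2]
    have b3 : ε' * D < ε / 2 := by
      rw [hε', div_mul_eq_mul_div, div_lt_div_iff₀ (by positivity) (by positivity)]
      nlinarith
    have b4 : Q * ∫ t in Ioc η R, |u σ t - f t| ≤ ε / 2 := by
      have : Q * (∫ t in Ioc η R, |u σ t - f t|) ≤ Q * (ε / (2 * (Q + 1))) := by gcongr
      refine this.trans ?_
      rw [mul_div_assoc', div_le_div_iff₀ (by positivity) (by positivity)]
      nlinarith
    calc _ ≤ _ := abs_add_le _ _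
      _ < ε := by linarith
  have hψlam : ∀ t, lam ≤ t → ψ t = 0 := fun t ht => hψs t (fun h => by linarith [h.2])
  have hψ00 : ψ 0 = 1 := hψδ 0 (by simpa using hδ0.le)
  refine ⟨m / 2 - ∫ t in Ioi (0:ℝ), f t * ψ t, hfR, ?_⟩
  intro h R hh hR
  have hq := lemA (fun t => h t - h 0 * ψ t) (max R lam) (by fun_prop) (by simp [hψ00]) (by
    intro t ht
    rw [hR t ((le_max_left _ _).trans ht), hψlam t ((le_max_right _ _).trans ht)]; ring)
  have hm2 : Tendsto (fun σ : ℝ => h 0 * ∫ t in Ioi (0:ℝ), u σ t * ψ t) (nhdsWithin 1 (Ioi 1))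
      (nhds (h 0 * (m / 2))) := by
    refine Tendsto.const_mul _ ((hm.div_const 2).congr fun σ => ?_)
    have : ∫ t, u σ t * ψ t = ∫ t, (fun t => u σ t * ψ t) |t| := by
      congr 1; ext t
      rcases abs_cases t with ⟨h, _⟩ | ⟨h, _⟩
      · simp only [h]
      · simp only [h, heven, hψe]
    rw [this, integral_comp_abs (f := fun t => u σ t * ψ t)]; ring
  have hsum := hq.add hm2
  have hlast : ∀ v : ℝ → ℝ, (∀ R, IntegrableOn v (Ioc 0 R)) →
      ∫ t in Ioi (0:ℝ), v t * (h t - h 0 * ψ t) = (∫ t in Ioi (0:ℝ), v t * h t) -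
        h 0 * ∫ t in Ioi (0:ℝ), v t * ψ t := by
    intro v hv
    rw [← integral_const_mul, ← integral_sub (prodint v h R (hv R) hh hR)
      ((prodint v ψ lam (hv lam) hψ hψlam).const_mul _)]
    congr 1; ext t; ring
  have elim : (∫ t in Ioi (0:ℝ), f t * (h t - h 0 * ψ t)) + h 0 * (m / 2) =
      (m / 2 - ∫ t in Ioi (0:ℝ), f t * ψ t) * h 0 + ∫ t in Ioi (0:ℝ), f t * h t := by
    rw [hlast f hfR]; ring
  rw [elim] at hsum
  refine hsum.congr' ?_
  filter_upwards [hE] with σ hσ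
  rw [hlast (u σ) (fun R => uc 0 R σ hσ.1)]; ring

noncomputable def wik (R v : ℝ) : ℝ := R / 2 * Real.sinc (R * v / 2) ^ 2

noncomputable def wiphi (R t : ℝ) : ℝ := max 0 (1 - t / R)

noncomputable def wiK (R y x : ℝ) : ℝ := (wik R (x - y) + wik R (x + y)) / 2

theorem wiphi_cont (R : ℝ) : Continuous (wiphi R) := by unfold wiphi; fun_prop

theorem wiphi_zero (R t : ℝ) (hR : 0 < R) (ht : R ≤ t) : wiphi R t = 0 := by
  unfold wiphi
  rw [max_eq_left]
  have : 1 ≤ t / R := by rwa [le_div_iff₀ hR, one_mul]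
  linarith

theorem wiphi_at_zero (R : ℝ) : wiphi R 0 = 1 := by simp [wiphi]

theorem wik_cont (R : ℝ) : Continuous (wik R) := by
  unfold wik
  have := Real.continuous_sinc
  fun_prop

theorem wik_nonneg (R v : ℝ) (hR : 0 < R) : 0 ≤ wik R v := by unfold wik; positivity

theorem wik_neg (R v : ℝ) : wik R (-v) = wik R v := by
  unfold wik
  rw [show R * -v / 2 = -(R * v / 2) by ring, Real.sinc_neg]

theorem wik_eq (R v : ℝ) (hR : 0 < R) (hv : v ≠ 0) :
    wik R v = (1 - Real.cos (R * v)) / (R * v ^ 2) := by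
  unfold wik
  rw [Real.sinc_of_ne_zero (by positivity), div_pow, Real.sin_sq_eq_half_sub,
    show 2 * (R * v / 2) = R * v by ring]
  field_simp

theorem wik_le (R v : ℝ) (hR : 0 < R) : wik R v ≤ R / 2 := by
  unfold wik
  have h := Real.abs_sinc_le_one (R * v / 2)
  have : Real.sinc (R * v / 2) ^ 2 ≤ 1 := by rw [sq_le_one_iff_abs_le_one]; exact h
  nlinarith

theorem wik_le' (R v : ℝ) (hR : 0 < R) (hv : v ≠ 0) : wik R v ≤ 2 / (R * v ^ 2) := by
  rw [wik_eq R v hR hv]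
  gcongr
  linarith [Real.neg_one_le_cos (R * v)]

theorem wik_tail (R v r : ℝ) (hR : 0 < R) (hr : 0 < r) (hv : r ≤ |v|) :
    wik R v ≤ 2 / R * (1 + 1 / r ^ 2) * (1 + v ^ 2)⁻¹ := by
  have hv0 : v ≠ 0 := by
    rintro rfl; simp at hv; linarith
  refine (wik_le' R v hR hv0).trans ?_
  have h1 : r ^ 2 ≤ v ^ 2 := by rw [← sq_abs v]; gcongr
  have hv2 : 0 < v ^ 2 := by positivity
  have h2 : 2 / (R * v ^ 2) = 2 / R * (1 / v ^ 2) := by field_simp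
  rw [h2, mul_assoc]
  gcongr
  rw [← div_eq_mul_inv, div_le_div_iff₀ hv2 (by positivity)]
  have h3 : 1 ≤ 1 / r ^ 2 * v ^ 2 := by
    rw [one_div_mul_eq_div, le_div_iff₀ (by positivity)]; linarith
  nlinarith

theorem wik_le_all (R v : ℝ) (hR : 0 < R) : wik R v ≤ (R + 4 / R) * (1 + v ^ 2)⁻¹ := by
  rcases le_or_gt 1 |v| with h | h
  · refine (wik_tail R v 1 hR one_pos h).trans ?_
    gcongr
    norm_num
    rw [show 2 / R * 2 = 4 / R by ring]; linarith
  · refine (wik_le R v hR).trans ?_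
    have h1 : v ^ 2 < 1 := by rwa [sq_lt_one_iff_abs_lt_one]
    rw [← div_eq_mul_inv, le_div_iff₀ (by positivity)]
    have : 0 < 4 / R := by positivity
    nlinarith

theorem wik_int (R : ℝ) (hR : 0 < R) : Integrable (wik R) := by
  refine (integrable_inv_one_add_sq.const_mul (R + 4 / R)).mono' (wik_cont R).aestronglyMeasurable ?_
  filter_upwards with v
  rw [Real.norm_eq_abs, abs_of_nonneg (wik_nonneg R v hR)]
  exact wik_le_all R v hR

theorem wik_formula (R v : ℝ) (hR : 0 < R) :
    ∫ t in Ioi (0:ℝ), wiphi R t * Real.cos (t * v) = wik R v := by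
  have e0 : ∫ t in Ioi (0:ℝ), wiphi R t * Real.cos (t * v) =
      ∫ t in (0:ℝ)..R, (1 - t / R) * Real.cos (t * v) := by
    rw [intervalIntegral.integral_of_le hR.le]
    rw [setIntegral_eq_of_subset_of_forall_sdiff_eq_zero measurableSet_Ioi
      (show Ioc 0 R ⊆ Ioi 0 from fun t ht => ht.1)]
    · refine setIntegral_congr_fun measurableSet_Ioc fun t ht => ?_
      unfold wiphi
      rw [max_eq_right]
      have := ht.2
      have : t / R ≤ 1 := by rwa [div_le_one hR]
      linarith
    · intro t ht
      have : R ≤ t := by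
        by_contra hh
        exact ht.2 ⟨ht.1, (not_le.1 hh).le⟩
      rw [wiphi_zero R t hR this, zero_mul]
  rw [e0]
  by_cases hv : v = 0
  · subst hv
    have hd : ∀ t ∈ uIcc 0 R, HasDerivAt (fun t : ℝ => t - t ^ 2 / (2 * R))
        ((1 - t / R) * Real.cos (t * 0)) t := by
      intro t _
      have h1 := (hasDerivAt_id t).sub (((hasDerivAt_id t).pow 2).div_const (2 * R))
      refine h1.congr_deriv ?_
      simp
      field_simp
    rw [intervalIntegral.integral_eq_sub_of_hasDerivAt hd (by
      apply Continuous.intervalIntegrable; fun_prop)]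
    unfold wik
    simp
    field_simp
    ring
  · have hd : ∀ t ∈ uIcc 0 R, HasDerivAt (fun t : ℝ => (1 - t / R) * (Real.sin (t * v) / v)
        - Real.cos (t * v) / (R * v ^ 2))
        ((1 - t / R) * Real.cos (t * v)) t := by
      intro t _
      have hl : HasDerivAt (fun t : ℝ => t * v) v t := by
        simpa using (hasDerivAt_id t).mul_const v
      have h1 : HasDerivAt (fun t : ℝ => 1 - t / R) (-(1 / R)) t :=
        ((hasDerivAt_id t).div_const R).const_sub 1
      have h2 := (h1.mul (hl.sin.div_const v)).sub (hl.cos.div_const (R * v ^ 2))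
      refine h2.congr_deriv ?_
      field_simp
      ring
    rw [intervalIntegral.integral_eq_sub_of_hasDerivAt hd (by
      apply Continuous.intervalIntegrable; fun_prop), wik_eq R v hR hv]
    have : R / R = 1 := div_self hR.ne'
    simp [this]
    field_simp
    ring

theorem wiphi_int (R : ℝ) (hR : 0 < R) : IntegrableOn (wiphi R) (Ioi 0) := by
  have h1 : IntegrableOn (wiphi R) (Ioc 0 R) :=
    ((wiphi_cont R).integrableOn_Icc).mono_set Ioc_subset_Icc_self
  refine h1.of_forall_sdiff_eq_zero measurableSet_Ioi ?_
  intro t ht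
  have : R ≤ t := by
    by_contra hh
    exact ht.2 ⟨ht.1, (not_le.1 hh).le⟩
  exact wiphi_zero R t hR this

theorem wiK_formula (R y x : ℝ) (hR : 0 < R) :
    ∫ t in Ioi (0:ℝ), (wiphi R t * Real.cos (y * t)) * Real.cos (t * x) = wiK R y x := by
  have ii : ∀ v, IntegrableOn (fun t => wiphi R t * Real.cos (t * v)) (Ioi 0) := by
    intro v
    refine Integrable.mul_bdd (c := 1) (wiphi_int R hR) (by fun_prop) ?_
    filter_upwards with t
    exact Real.abs_cos_le_one _
  unfold wiK
  rw [← wik_formula R _ hR, ← wik_formula R _ hR, ← integral_add (ii _) (ii _), ← integral_div]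
  congr 1; ext t
  rw [mul_sub, mul_add, Real.cos_sub, Real.cos_add, mul_comm y t]
  ring

theorem wiK_cont (R y : ℝ) : Continuous (wiK R y) := by
  unfold wiK
  have := wik_cont R
  fun_prop

theorem wiK_nonneg (R y x : ℝ) (hR : 0 < R) : 0 ≤ wiK R y x := by
  unfold wiK
  linarith [wik_nonneg R (x - y) hR, wik_nonneg R (x + y) hR]

theorem wiK_le (R y x : ℝ) (hR : 0 < R) : wiK R y x ≤ R / 2 := by
  unfold wiK
  linarith [wik_le R (x - y) hR, wik_le R (x + y) hR]

theorem wiK_tail (R y x r : ℝ) (hR : 0 < R) (hr : 0 < r) (hx : 0 < x) (hy : 0 < y)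
    (h : r ≤ |x - y|) :
    wiK R y x ≤ 2 / R * (1 + 1 / r ^ 2) * (1 + (x - y) ^ 2)⁻¹ := by
  have h1 := wik_tail R (x - y) r hR hr h
  have hxy : |x - y| ≤ |x + y| := by
    rw [abs_of_pos (by linarith : 0 < x + y), abs_le]
    constructor <;> linarith
  have h2 := wik_tail R (x + y) r hR hr (h.trans hxy)
  have h3 : 2 / R * (1 + 1 / r ^ 2) * (1 + (x + y) ^ 2)⁻¹ ≤ 2 / R * (1 + 1 / r ^ 2) * (1 + (x - y) ^ 2)⁻¹ := by
    gcongr 2 / R * (1 + 1 / r ^ 2) * (1 + ?_)⁻¹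
    exact sq_le_sq.2 hxy
  unfold wiK
  linarith

theorem wiK_int (R y : ℝ) (hR : 0 < R) : Integrable (wiK R y) :=
  (((wik_int R hR).comp_sub_right y).add ((wik_int R hR).comp_add_right y)).div_const 2

theorem wik_scale (R : ℝ) (hR : 0 < R) : ∫ v, wik R v = ∫ v, wik 1 v := by
  have h := Measure.integral_comp_mul_left (fun v => wik 1 v) R
  have e : ∀ v, wik R v = R * wik 1 (R * v) := by
    intro v; unfold wik; rw [one_mul]; ring
  simp_rw [e]
  rw [integral_const_mul, h, abs_of_pos (by positivity), smul_eq_mul]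
  field_simp

theorem wiK_mass (R y : ℝ) (hR : 0 < R) :
    ∫ x in Ioi (0:ℝ), wiK R y x = (∫ v, wik 1 v) / 2 := by
  rw [← wik_scale R hR]
  unfold wiK
  rw [integral_div, integral_add ((wik_int R hR).comp_sub_right y).integrableOn
    ((wik_int R hR).comp_add_right y).integrableOn]
  have e1 : ∫ x in Ioi (0:ℝ), wik R (x - y) = ∫ x in Iic (0:ℝ), wik R (x + y) := by
    have := integral_comp_neg_Iic (0:ℝ) (fun x => wik R (x - y))
    rw [neg_zero] at this
    rw [← this]
    congr 1; ext x
    rw [← wik_neg]; congr 1; ring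
  rw [e1, add_comm, ← compl_Ioi, integral_add_compl measurableSet_Ioi ((wik_int R hR).comp_add_right y),
    integral_add_right_eq_self (wik R) y]

theorem wik_lower (v : ℝ) (hv : |v| ≤ 1) : 1 / 4 ≤ wik 1 v := by
  have key : ∀ v : ℝ, 0 ≤ v → v ≤ 1 → 1 / 4 ≤ wik 1 v := by
    intro v h0 h1
    rcases h0.eq_or_lt with rfl | h0
    · simp [wik]; norm_num
    · unfold wik
      rw [one_mul, Real.sinc_of_ne_zero (by positivity)]
      have h3 := Real.sin_gt_sub_cube (x := v / 2) (by positivity)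
      have h4 : 3 / 4 ≤ Real.sin (v / 2) / (v / 2) := by
        rw [le_div_iff₀ (by positivity)]
        have : (v/2)^3 ≤ v / 2 * (1/4) := by nlinarith [mul_pos h0 h0, sq_nonneg v]
        linarith [h3, pow_pos (half_pos h0) 3]
      nlinarith
  rcases abs_cases v with ⟨h, h'⟩ | ⟨h, h'⟩
  · exact key v h' (by linarith)
  · rw [← wik_neg]; exact key (-v) (by linarith) (by linarith)

theorem wik_mass_pos : 0 < ∫ v, wik 1 v := by
  have h1 : ∫ v in Icc (0:ℝ) 1, (1/4:ℝ) ≤ ∫ v in Icc (0:ℝ) 1, wik 1 v := by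
    refine setIntegral_mono_on (by simp) (wik_int 1 one_pos).integrableOn measurableSet_Icc fun v hv => ?_
    exact wik_lower v (by rw [abs_of_nonneg hv.1]; exact hv.2)
  have h2 : ∫ v in Icc (0:ℝ) 1, wik 1 v ≤ ∫ v, wik 1 v :=
    setIntegral_le_integral (wik_int 1 one_pos) (by filter_upwards with v; exact wik_nonneg 1 v one_pos)
  simp at h1
  linarith

/-- Fatou type lemma. -/
theorem wi_fatou (W W2 : ℝ → ℝ) (l : ℝ)
    (hW : ∀ ε : ℝ, 0 < ε → IntegrableOn (fun x => Real.exp (-ε * x) * W x) (Ioi 0))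
    (hWm : AEStronglyMeasurable W (volume.restrict (Ioi 0)))
    (hW2 : IntegrableOn W2 (Ioi 0)) (hpos : ∀ x, 0 < x → W2 x ≤ W x)
    (hl : Tendsto (fun ε : ℝ => ∫ x in Ioi (0:ℝ), Real.exp (-ε * x) * W x) (nhdsWithin 0 (Ioi 0)) (nhds l)) :
    IntegrableOn W (Ioi 0) ∧ ∫ x in Ioi (0:ℝ), W x = l := by
  have dom : ∀ V : ℝ → ℝ, IntegrableOn V (Ioi 0) →
      Tendsto (fun ε : ℝ => ∫ x in Ioi (0:ℝ), Real.exp (-ε * x) * V x) (nhdsWithin 0 (Ioi 0))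
        (nhds (∫ x in Ioi (0:ℝ), V x)) := by
    intro V hV
    refine tendsto_integral_filter_of_dominated_convergence (fun x => ‖V x‖) ?_ ?_ hV.norm ?_
    · filter_upwards with ε
      exact (by fun_prop : AEStronglyMeasurable (fun x : ℝ => Real.exp (-ε * x)) _).mul hV.aestronglyMeasurable
    · filter_upwards [self_mem_nhdsWithin] with ε hε
      filter_upwards [ae_restrict_mem measurableSet_Ioi] with x hx
      have hx : 0 < x := hx
      have hε : 0 < ε := hε
      rw [norm_mul, Real.norm_eq_abs, Real.abs_exp]
      apply mul_le_of_le_one_left (norm_nonneg _)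
      rw [Real.exp_le_one_iff]; nlinarith
    · filter_upwards with x
      have : Continuous (fun ε : ℝ => Real.exp (-ε * x) * V x) := by fun_prop
      have h := this.tendsto 0
      rw [neg_zero, zero_mul, Real.exp_zero, one_mul] at h
      exact h.mono_left nhdsWithin_le_nhds
  have hKint : IntegrableOn W (Ioi 0) := by
    have e2 : ∀ ε : ℝ, 0 < ε → IntegrableOn (fun x => Real.exp (-ε * x) * W2 x) (Ioi 0) := by
      intro ε hε
      refine Integrable.bdd_mul (c := 1) hW2 (by fun_prop) ?_
      filter_upwards [ae_restrict_mem measurableSet_Ioi] with x hx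
      have hx : 0 < x := hx
      rw [Real.norm_eq_abs, Real.abs_exp, Real.exp_le_one_iff]; nlinarith
    have hl1 : Tendsto (fun ε : ℝ => ∫ x in Ioi (0:ℝ), Real.exp (-ε * x) * (W x - W2 x))
        (nhdsWithin 0 (Ioi 0)) (nhds (l - ∫ x in Ioi (0:ℝ), W2 x)) := by
      refine (hl.sub (dom W2 hW2)).congr' ?_
      filter_upwards [self_mem_nhdsWithin] with ε hε
      rw [← integral_sub (hW ε hε) (e2 ε hε)]
      congr 1; ext x; ring
    set l1 := l - ∫ x in Ioi (0:ℝ), W2 x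
    have hseq : Tendsto (fun n : ℕ => 1 / ((n:ℝ) + 1)) atTop (nhdsWithin 0 (Ioi 0)) :=
      tendsto_nhdsWithin_iff.2 ⟨tendsto_one_div_add_atTop_nhds_zero_nat,
        Eventually.of_forall fun n => by
          have : (0:ℝ) < 1 / ((n:ℝ) + 1) := by positivity
          exact this⟩
    have hlt := hl1.comp hseq
    have hpn : ∀ n : ℕ, (0:ℝ) < 1 / ((n:ℝ) + 1) := fun n => by positivity
    have h1 : Integrable (fun x => W x - W2 x) (volume.restrict (Ioi 0)) := by
      refine ⟨hWm.sub hW2.aestronglyMeasurable, ?_⟩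
      have hf := lintegral_liminf_le' (u := atTop) (μ := volume.restrict (Ioi (0:ℝ)))
        (f := fun (n : ℕ) x => ‖Real.exp (-(1 / ((n:ℝ) + 1)) * x) * (W x - W2 x)‖ₑ) (by
          intro n
          exact ((by fun_prop : AEStronglyMeasurable (fun x : ℝ => Real.exp (-(1 / ((n:ℝ) + 1)) * x)) _).mul
            (hWm.sub hW2.aestronglyMeasurable)).enorm)
      have hr : ∀ n : ℕ, ∫⁻ x in Ioi (0:ℝ), ‖Real.exp (-(1 / ((n:ℝ) + 1)) * x) * (W x - W2 x)‖ₑ =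
          ENNReal.ofReal (∫ x in Ioi (0:ℝ), Real.exp (-(1 / ((n:ℝ) + 1)) * x) * (W x - W2 x)) := by
        intro n
        have ii : Integrable (fun x => Real.exp (-(1 / ((n:ℝ) + 1)) * x) * (W x - W2 x))
            (volume.restrict (Ioi 0)) := by
          simp only [mul_sub]
          exact (hW _ (hpn n)).sub (e2 _ (hpn n))
        rw [ofReal_integral_eq_lintegral_ofReal ii]
        · refine setLIntegral_congr_fun measurableSet_Ioi fun x hx => ?_
          rw [Real.enorm_eq_ofReal]
          exact mul_nonneg (Real.exp_pos _).le (sub_nonneg.2 (hpos x hx))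
        · filter_upwards [ae_restrict_mem measurableSet_Ioi] with x hx
          exact mul_nonneg (Real.exp_pos _).le (sub_nonneg.2 (hpos x hx))
      simp_rw [hr] at hf
      have hlim : Tendsto (fun n : ℕ => ENNReal.ofReal (∫ x in Ioi (0:ℝ),
          Real.exp (-(1 / ((n:ℝ) + 1)) * x) * (W x - W2 x))) atTop (nhds (ENNReal.ofReal l1)) :=
        (ENNReal.continuous_ofReal.tendsto _).comp hlt
      rw [hlim.liminf_eq] at hf
      have hpt : ∀ x : ℝ, liminf (fun n : ℕ => ‖Real.exp (-(1 / ((n:ℝ) + 1)) * x) * (W x - W2 x)‖ₑ) atTop =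
          ‖W x - W2 x‖ₑ := by
        intro x
        apply Tendsto.liminf_eq
        have hc : Continuous (fun ε : ℝ => ‖Real.exp (-ε * x) * (W x - W2 x)‖ₑ) := by fun_prop
        have := (hc.tendsto 0).comp (tendsto_one_div_add_atTop_nhds_zero_nat (𝕜 := ℝ))
        simpa [Function.comp_def] using this
      simp_rw [hpt] at hf
      exact hf.trans_lt ENNReal.ofReal_lt_top
    have h2 := h1.add hW2
    refine h2.congr ?_
    filter_upwards with x
    simp
  exact ⟨hKint, tendsto_nhds_unique (dom W hKint) hl⟩

theorem wi_slow (S : ℝ → ℝ) (h x₀ : ℝ) (hh : 0 < h)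
    (H : ∀ x y : ℝ, x₀ ≤ x → x ≤ y → y ≤ x + h → (S y - S x) / Real.exp x ≥ -1) :
    ∃ D : ℝ, 0 ≤ D ∧ ∀ x y, x₀ ≤ x → x ≤ y → S x - D * Real.exp y ≤ S y := by
  have he : 0 < Real.exp h - 1 := by
    have := Real.add_one_lt_exp hh.ne'
    linarith
  have H' : ∀ x y : ℝ, x₀ ≤ x → x ≤ y → y ≤ x + h → S x - Real.exp x ≤ S y := by
    intro x y h1 h2 h3
    have := H x y h1 h2 h3
    rw [ge_iff_le, le_div_iff₀ (Real.exp_pos x)] at this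
    linarith
  set D := 1 / (Real.exp h - 1) + 1 with hD
  have hDp : 1 ≤ D := by
    have : 0 < 1 / (Real.exp h - 1) := by positivity
    linarith
  have hD2 : D + 1 ≤ D * Real.exp h := by
    have : 1 / (Real.exp h - 1) * (Real.exp h - 1) = 1 := by field_simp
    nlinarith
  refine ⟨D, by linarith, ?_⟩
  have key : ∀ n : ℕ, ∀ x y, x₀ ≤ x → x ≤ y → y ≤ x + (n + 1) * h → S x - D * Real.exp y ≤ S y := by
    intro n
    induction n with
    | zero =>
      intro x y h1 h2 h3
      have a1 := H' x y h1 h2 (by simpa using h3)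
      have a2 := Real.exp_le_exp.2 h2
      have a3 := Real.exp_pos y
      nlinarith
    | succ n ih =>
      intro x y h1 h2 h3
      push_cast at h3
      rcases le_or_gt y (x + h) with hy | hy
      · refine ih x y h1 h2 (hy.trans ?_)
        have : (0:ℝ) ≤ n := by positivity
        nlinarith
      · have a1 := ih x (y - h) h1 (by linarith) (by linarith)
        have a2 := H' (y - h) y (by linarith) (by linarith) (by linarith)
        have a3 : Real.exp y = Real.exp (y - h) * Real.exp h := by
          rw [← Real.exp_add]; congr 1; ring
        have a4 := Real.exp_pos (y - h)
        nlinarith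
  intro x y h1 h2
  obtain ⟨n, hn⟩ := exists_nat_gt ((y - x) / h)
  refine key n x y h1 h2 ?_
  rw [div_lt_iff₀ hh] at hn
  linarith

theorem wi_P (T P : ℝ → ℝ) (R r y x1 Q : ℝ) (hR : 0 < R) (hr : 0 < r) (hy : 0 < y) (hQ : 0 ≤ Q)
    (hT : IntegrableOn T (Ioc 0 x1))
    (hP : IntegrableOn (fun x => P x * wiK R y x) (Ioi 0))
    (hpos : ∀ x, |x - y| ≤ r → 0 ≤ P x)
    (hlow : ∀ x, 0 < x → -((Ioc 0 x1).indicator (fun x => |T x|) x + Q) ≤ P x) :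
    -(2 / R * (1 + 1 / r ^ 2) * ((∫ x in Ioc 0 x1, |T x|) + Q * Real.pi)) ≤
      ∫ x in Ioi (0:ℝ), P x * wiK R y x := by
  set c := 2 / R * (1 + 1 / r ^ 2) with hc
  have hc0 : 0 < c := by positivity
  have hinv : Integrable (fun x : ℝ => (1 + (x - y) ^ 2)⁻¹) :=
    integrable_inv_one_add_sq.comp_sub_right y
  have i1 : Integrable ((Ioc 0 x1).indicator (fun x => |T x|)) := IntegrableOn.integrable_indicator (show IntegrableOn (fun x => |T x|) (Ioc 0 x1) volume from hT.abs) measurableSet_Ioc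
  have i2 : Integrable (fun x => c * ((Ioc 0 x1).indicator (fun x => |T x|) x + Q * (1 + (x - y) ^ 2)⁻¹)) :=
    (i1.add (hinv.const_mul Q)).const_mul c
  have hind : ∀ x, 0 ≤ (Ioc 0 x1).indicator (fun x => |T x|) x :=
    fun x => indicator_nonneg (fun _ _ => abs_nonneg _) x
  have e1 : ∫ x, c * ((Ioc 0 x1).indicator (fun x => |T x|) x + Q * (1 + (x - y) ^ 2)⁻¹) =
      c * ((∫ x in Ioc 0 x1, |T x|) + Q * Real.pi) := by
    rw [integral_const_mul, integral_add i1 (hinv.const_mul Q), integral_indicator measurableSet_Ioc,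
      integral_const_mul, integral_sub_right_eq_self (fun x : ℝ => (1 + x ^ 2)⁻¹) y,
      integral_univ_inv_one_add_sq]
  rw [← e1]
  have e2 : ∫ x in Ioi (0:ℝ), c * ((Ioc 0 x1).indicator (fun x => |T x|) x + Q * (1 + (x - y) ^ 2)⁻¹) ≤
      ∫ x, c * ((Ioc 0 x1).indicator (fun x => |T x|) x + Q * (1 + (x - y) ^ 2)⁻¹) := by
    refine setIntegral_le_integral i2 ?_
    filter_upwards with x
    have := hind x
    simp only [Pi.zero_apply]
    positivity
  have e3 : ∫ x in Ioi (0:ℝ), -(c * ((Ioc 0 x1).indicator (fun x => |T x|) x + Q * (1 + (x - y) ^ 2)⁻¹)) ≤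
      ∫ x in Ioi (0:ℝ), P x * wiK R y x := by
    refine setIntegral_mono_on i2.integrableOn.neg hP measurableSet_Ioi fun x hx => ?_
    have hx : 0 < x := hx
    have h1 := hind x
    have hK := wiK_nonneg R y x hR
    have hi : 0 < (1 + (x - y) ^ 2)⁻¹ := by positivity
    have hi1 : (1 + (x - y) ^ 2)⁻¹ ≤ 1 := inv_le_one_of_one_le₀ (by nlinarith [sq_nonneg (x - y)])
    rcases le_or_gt |x - y| r with h | h
    · have : 0 ≤ P x * wiK R y x := mul_nonneg (hpos x h) hK
      have : 0 ≤ c * ((Ioc 0 x1).indicator (fun x => |T x|) x + Q * (1 + (x - y) ^ 2)⁻¹) := by positivity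
      linarith
    · have h2 := wiK_tail R y x r hR hr hx hy h.le
      rw [← hc] at h2
      have h3 := hlow x hx
      set I := (Ioc 0 x1).indicator (fun x => |T x|) x
      set w := (1 + (x - y) ^ 2)⁻¹
      have h4 : -((I + Q) * wiK R y x) ≤ P x * wiK R y x := by nlinarith
      have h5 : (I + Q) * wiK R y x ≤ (I + Q) * (c * w) := by gcongr
      have h6 : (I + Q) * (c * w) ≤ c * (I + Q * w) := by
        have : c * (I * w) ≤ c * I := by
          gcongr
          exact mul_le_of_le_one_right h1 hi1
        nlinarith
      linarith
  rw [integral_neg] at e3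
  linarith

set_option maxHeartbeats 1000000 in
theorem wi_taub (S T : ℝ → ℝ) (hTS : ∀ x, T x = Real.exp (-x) * S x)
    (hloc : ∀ X, IntegrableOn T (Ioc 0 X))
    (hslow : ∀ ε : ℝ, 0 < ε → ∃ h : ℝ, 0 < h ∧ ∃ x₀ : ℝ, 0 < x₀ ∧ ∀ x y : ℝ,
      x₀ ≤ x → x ≤ y → y ≤ x + h → (S y - S x) / Real.exp x ≥ -ε)
    (c : ℝ)
    (hKint : ∀ R y : ℝ, 0 < R → IntegrableOn (fun x => T x * wiK R y x) (Ioi 0))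
    (hlim : ∀ R : ℝ, 0 < R → Tendsto (fun y => ∫ x in Ioi (0:ℝ), T x * wiK R y x) atTop (nhds c)) :
    Tendsto T atTop (nhds (2 * c / ∫ v, wik 1 v)) := by
  set κ := ∫ v, wik 1 v with hκ
  have hκ0 : 0 < κ := wik_mass_pos
  obtain ⟨h0, hh0, x₀, hx₀, H0⟩ := hslow 1 one_pos
  obtain ⟨D, hD0, hD⟩ := wi_slow S h0 x₀ hh0 H0
  have hTD : ∀ x y, x₀ ≤ x → x ≤ y → Real.exp (x - y) * T x - D ≤ T y := by
    intro x y h1 h2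
    have a1 := hD x y h1 h2
    have a2 := Real.exp_pos (-y)
    have a3 : Real.exp (-y) * Real.exp y = 1 := by rw [← Real.exp_add]; simp
    have a4 : Real.exp (x - y) * Real.exp (-x) = Real.exp (-y) := by
      rw [← Real.exp_add]; congr 1; ring
    rw [hTS, hTS, ← mul_assoc, a4]
    nlinarith [mul_le_mul_of_nonneg_left a1 a2.le]
  set M := |T x₀| + D with hM
  have hM0 : 0 ≤ M := by positivity
  have hlow : ∀ y, x₀ ≤ y → -M ≤ T y := by
    intro y hy
    have a1 := hTD x₀ y le_rfl hy
    have a2 : Real.exp (x₀ - y) ≤ 1 := by rw [Real.exp_le_one_iff]; linarith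
    have a3 := Real.exp_pos (x₀ - y)
    have a4 : -|T x₀| ≤ Real.exp (x₀ - y) * T x₀ := by
      have := neg_abs_le (T x₀)
      have := abs_nonneg (T x₀)
      nlinarith
    linarith
  -- upper bound
  obtain ⟨x1, hx1, M', hM'⟩ : ∃ x1, x₀ ≤ x1 ∧ ∃ M', ∀ x, x1 ≤ x → |T x| ≤ M' := by
    obtain ⟨y0, hy0⟩ := eventually_atTop.1 ((hlim 1 one_pos).eventually (gt_mem_nhds (lt_add_one c)))
    set A := ∫ x in Ioc 0 x₀, |T x| with hA
    have hA0 : 0 ≤ A := integral_nonneg fun x => abs_nonneg _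
    set M2 := |8 * Real.exp 1 * (c + 1 + M * (κ / 2) + A)| with hM2
    have up : ∀ y, max x₀ y0 ≤ y → T y ≤ M2 := by
      intro y hy
      have hy1 : x₀ ≤ y := (le_max_left _ _).trans hy
      have hy2 := hy0 y ((le_max_right _ _).trans hy)
      rcases le_or_gt (T y) 0 with hn | hn
      · exact hn.trans (abs_nonneg _)
      set E := 1 / 8 * (Real.exp (-1) * T y) with hE
      have hE0 : 0 < E := by positivity
      have hi1 : Integrable ((Ioc 0 x₀).indicator (fun x => |T x|)) :=
        IntegrableOn.integrable_indicator (show IntegrableOn (fun x => |T x|) (Ioc 0 x₀) volume from (hloc x₀).abs) measurableSet_Ioc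
      have hi2 : Integrable ((Ioc y (y+1)).indicator (fun _ => E)) :=
        (integrableOn_const (by simp)).integrable_indicator measurableSet_Ioc
      have hi3 : IntegrableOn (fun x => T x * wiK 1 y x + M * wiK 1 y x) (Ioi 0) :=
        (hKint 1 y one_pos).add ((wiK_int 1 y one_pos).const_mul M).integrableOn
      have hle : ∫ x in Ioi (0:ℝ), (Ioc y (y+1)).indicator (fun _ => E) x ≤
          ∫ x in Ioi (0:ℝ), ((T x * wiK 1 y x + M * wiK 1 y x) + (Ioc 0 x₀).indicator (fun x => |T x|) x) := by
        refine setIntegral_mono_on hi2.integrableOn (hi3.add hi1.integrableOn) measurableSet_Ioi fun x hx => ?_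
        have hx : 0 < x := hx
        have hK := wiK_nonneg 1 y x one_pos
        have hK2 := wiK_le 1 y x one_pos
        have hind : 0 ≤ (Ioc 0 x₀).indicator (fun x => |T x|) x :=
          indicator_nonneg (fun _ _ => abs_nonneg _) x
        by_cases hm : x ∈ Ioc y (y+1)
        · rw [indicator_of_mem hm]
          have b1 := hTD y x hy1 hm.1.le
          have b2 : Real.exp (-1) ≤ Real.exp (y - x) := Real.exp_le_exp.2 (by linarith [hm.2])
          have b3 : Real.exp (-1) * T y ≤ T x + M := by
            have : D ≤ M := by rw [hM]; linarith [abs_nonneg (T x₀)]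
            nlinarith
          have b4 : 1 / 8 ≤ wiK 1 y x := by
            unfold wiK
            have := wik_lower (x - y) (by rw [abs_of_pos (by linarith [hm.1])]; linarith [hm.2])
            linarith [wik_nonneg 1 (x + y) one_pos]
          have b5 : 0 < Real.exp (-1) * T y := by positivity
          have : E ≤ wiK 1 y x * (T x + M) := by
            rw [hE]; gcongr
          linarith
        · rw [indicator_of_notMem hm]
          rcases le_or_gt x x₀ with hxx | hxx
          · rw [indicator_of_mem (show x ∈ Ioc 0 x₀ from ⟨hx, hxx⟩)]
            have : 0 ≤ M * wiK 1 y x := by positivity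
            have := neg_abs_le (T x)
            have := abs_nonneg (T x)
            nlinarith
          · have := hlow x hxx.le
            have : 0 ≤ (T x + M) * wiK 1 y x := mul_nonneg (by linarith) hK
            linarith
      have l1 : ∫ x in Ioi (0:ℝ), (Ioc y (y+1)).indicator (fun _ => E) x = E := by
        rw [setIntegral_indicator measurableSet_Ioc, inter_eq_self_of_subset_right
          (show Ioc y (y+1) ⊆ Ioi 0 from fun x hx => show (0:ℝ) < x by linarith [hx.1])]
        simp
      have l2 : ∫ x in Ioi (0:ℝ), (Ioc 0 x₀).indicator (fun x => |T x|) x = A := by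
        rw [setIntegral_indicator measurableSet_Ioc, inter_eq_self_of_subset_right
          (show Ioc 0 x₀ ⊆ Ioi 0 from fun x hx => hx.1)]
      rw [l1, integral_add hi3 hi1.integrableOn, l2, integral_add (hKint 1 y one_pos)
        ((wiK_int 1 y one_pos).const_mul M).integrableOn, integral_const_mul, wiK_mass 1 y one_pos] at hle
      have l3 : T y = 8 * Real.exp 1 * E := by
        rw [hE, Real.exp_neg]; field_simp
      rw [l3]
      refine le_trans ?_ (le_abs_self _)
      gcongr
      linarith
    refine ⟨max x₀ y0, le_max_left _ _, max M M2, fun x hx => ?_⟩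
    rw [abs_le]
    constructor
    · have := hlow x ((le_max_left _ _).trans hx)
      have := le_max_left M M2
      linarith
    · exact (up x hx).trans (le_max_right _ _)
  have hM'0 : 0 ≤ M' := (abs_nonneg _).trans (hM' x1 le_rfl)
  have hx1p : 0 < x1 := hx₀.trans_le hx1
  -- slow decrease of T
  have hTs : ∀ ε : ℝ, 0 < ε → ∃ h, 0 < h ∧ ∃ x2, x1 ≤ x2 ∧ ∀ x y, x2 ≤ x → x ≤ y → y ≤ x + h →
      T x - ε ≤ T y := by
    intro ε hε
    obtain ⟨h, hh, x2, hx2, H⟩ := hslow (ε / 2) (by positivity)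
    refine ⟨min h (ε / (2 * (M' + 1))), by positivity, max x1 x2, le_max_left _ _, ?_⟩
    intro x y h1 h2 h3
    have hb := hM' x ((le_max_left _ _).trans h1)
    have a1 := H x y ((le_max_right _ _).trans h1) h2 (h3.trans (by linarith [min_le_left h (ε / (2 * (M' + 1)))]))
    rw [ge_iff_le, le_div_iff₀ (Real.exp_pos x)] at a1
    have a2 : Real.exp (-y) * Real.exp x = Real.exp (x - y) := by rw [← Real.exp_add]; congr 1; ring
    have a3 : T y ≥ Real.exp (x - y) * T x - ε / 2 * Real.exp (x - y) := by
      have : Real.exp (x - y) * Real.exp (-x) = Real.exp (-y) := by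
        rw [← Real.exp_add]; congr 1; ring
      rw [hTS, hTS, ← mul_assoc, this, ← a2]
      nlinarith [mul_le_mul_of_nonneg_left a1 (Real.exp_pos (-y)).le]
    have a4 : Real.exp (x - y) ≤ 1 := by rw [Real.exp_le_one_iff]; linarith
    have a5 := Real.add_one_le_exp (x - y)
    have a6 : (y - x) * M' ≤ ε / 2 := by
      have : y - x ≤ ε / (2 * (M' + 1)) := by linarith [min_le_right h (ε / (2 * (M' + 1)))]
      have e : ε / (2 * (M' + 1)) * (M' + 1) = ε / 2 := by field_simp
      nlinarith
    have a7 := abs_le.1 hb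
    have a8 : (1 - Real.exp (x - y)) * T x ≤ (y - x) * M' := by
      have s1 : (1 - Real.exp (x - y)) * T x ≤ (1 - Real.exp (x - y)) * M' :=
        mul_le_mul_of_nonneg_left a7.2 (by linarith)
      have s2 : (1 - Real.exp (x - y)) * M' ≤ (y - x) * M' :=
        mul_le_mul_of_nonneg_right (by linarith) hM'0
      linarith
    nlinarith
  -- conclusion
  rw [Metric.tendsto_atTop]
  intro ε hε
  obtain ⟨h, hh, x2, hx2, hs⟩ := hTs (ε / 4) (by positivity)
  set r := h / 2 with hr
  have hr0 : 0 < r := by positivity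
  set A := ∫ x in Ioc 0 x1, |T x| with hA
  have hA0 : 0 ≤ A := integral_nonneg fun x => abs_nonneg _
  set Q := 2 * M' + ε / 4 with hQ
  have hQ0 : 0 ≤ Q := by positivity
  set G := 2 * (1 + 1 / r ^ 2) * (A + Q * Real.pi) with hG
  have hG0 : 0 ≤ G := by have := Real.pi_pos; positivity
  set R := (G + 1) / (κ * ε / 16) with hRdef
  have hR : 0 < R := by positivity
  have hRG : 2 / R * (1 + 1 / r ^ 2) * (A + Q * Real.pi) ≤ κ * ε / 16 := by
    have : 2 / R * (1 + 1 / r ^ 2) * (A + Q * Real.pi) = G / R := by rw [hG]; ring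
    rw [this, div_le_iff₀ hR, hRdef]
    have : κ * ε / 16 * ((G + 1) / (κ * ε / 16)) = G + 1 := by field_simp
    linarith
  clear_value R
  obtain ⟨y0, hy0⟩ := Metric.tendsto_atTop.1 (hlim R hR) (κ * ε / 16) (by positivity)
  refine ⟨max x2 y0 + h + 1, fun z hz => ?_⟩
  have hz2 : x2 + h + 1 ≤ z := by linarith [le_max_left x2 y0]
  have hzy : y0 + h + 1 ≤ z := by linarith [le_max_right x2 y0]
  have hTz := abs_le.1 (hM' z (by linarith))
  have hrh : r ≤ h := by rw [hr]; linarith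
  have hca : κ * (2 * c / κ) = 2 * c := by field_simp
  have hmul : ∀ (s b y : ℝ), IntegrableOn (fun x => (s * T x + b) * wiK R y x) (Ioi 0) ∧
      ∫ x in Ioi (0:ℝ), (s * T x + b) * wiK R y x =
        s * (∫ x in Ioi (0:ℝ), T x * wiK R y x) + b * (κ / 2) := by
    intro s b y
    have i1 := (hKint R y hR).const_mul s
    have i2 := ((wiK_int R y hR).integrableOn (s := Ioi 0)).const_mul b
    have e : (fun x => (s * T x + b) * wiK R y x) =
        fun x => s * (T x * wiK R y x) + b * wiK R y x := by ext x; ring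
    rw [e]
    refine ⟨i1.add i2, ?_⟩
    rw [integral_add i1 i2, integral_const_mul, integral_const_mul, wiK_mass R y hR]
  have hbase : ∀ x, 0 < x → |T x| ≤ (Ioc 0 x1).indicator (fun x => |T x|) x + M' := by
    intro x hx
    rcases le_or_gt x x1 with hxx | hxx
    · rw [indicator_of_mem (show x ∈ Ioc 0 x1 from ⟨hx, hxx⟩)]; linarith
    · have := hM' x hxx.le
      have : 0 ≤ (Ioc 0 x1).indicator (fun x => |T x|) x :=
        indicator_nonneg (fun _ _ => abs_nonneg _) x
      linarith
  rw [Real.dist_eq, abs_lt]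
  constructor
  · -- lower bound
    have hy := hy0 (z - r) (by linarith)
    rw [Real.dist_eq, abs_lt] at hy
    obtain ⟨i1, e1⟩ := hmul (-1) (T z + ε / 4) (z - r)
    have hp := wi_P T (fun x => -1 * T x + (T z + ε / 4)) R r (z - r) x1 Q hR hr0 (by linarith) hQ0
      (hloc x1) i1 (by
        intro x hx
        rw [abs_le] at hx
        have := hs x z (by linarith) (by linarith [hx.2]) (by rw [hr] at hx; linarith [hx.1])
        linarith) (by
        intro x hx
        have := hbase x hx
        have := le_abs_self (T x)
        linarith [hTz.1])
    rw [e1] at hp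
    have : -(κ * ε / 8) ≤ κ * (T z + ε / 4) / 2 - c := by linarith
    by_contra hcon
    push Not at hcon
    have h9 : κ * (T z - 2 * c / κ) ≤ κ * (-ε) := by gcongr
    nlinarith [mul_pos hκ0 hε]
  · have hy := hy0 (z + r) (by linarith)
    rw [Real.dist_eq, abs_lt] at hy
    obtain ⟨i1, e1⟩ := hmul 1 (-T z + ε / 4) (z + r)
    have hp := wi_P T (fun x => 1 * T x + (-T z + ε / 4)) R r (z + r) x1 Q hR hr0 (by linarith) hQ0
      (hloc x1) i1 (by
        intro x hx
        rw [abs_le] at hx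
        have := hs z x (by linarith) (by linarith [hx.1]) (by rw [hr] at hx; linarith [hx.2])
        linarith) (by
        intro x hx
        have := hbase x hx
        have := neg_abs_le (T x)
        linarith [hTz.2])
    rw [e1] at hp
    have : -(κ * ε / 8) ≤ κ * (-T z + ε / 4) / 2 + c := by linarith
    by_contra hcon
    push Not at hcon
    have h9 : κ * ε ≤ κ * (T z - 2 * c / κ) := by gcongr
    nlinarith [mul_pos hκ0 hε]

theorem wi_abel (T : ℝ → ℝ) (a : ℝ)
    (hT : ∀ ε : ℝ, 0 < ε → IntegrableOn (fun x => Real.exp (-ε * x) * T x) (Ioi 0))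
    (hloc : ∀ X, IntegrableOn T (Ioc 0 X))
    (hlim : Tendsto T atTop (nhds a)) :
    Tendsto (fun ε : ℝ => ε * ∫ x in Ioi (0:ℝ), Real.exp (-ε * x) * T x) (nhdsWithin 0 (Ioi 0)) (nhds a) := by
  rw [Metric.tendsto_nhds]
  intro η hη
  obtain ⟨X0, hX0⟩ := Metric.tendsto_atTop.1 hlim (η / 2) (by positivity)
  set X := max X0 1
  have hX : ∀ x, X ≤ x → |T x - a| ≤ η / 2 := fun x hx => (hX0 x ((le_max_left _ _).trans hx)).le
  have hia : IntegrableOn (fun x => T x - a) (Ioc 0 X) := (hloc X).sub (integrableOn_const (by simp))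
  set A := ∫ x in Ioc 0 X, |T x - a| with hA
  have hA0 : 0 ≤ A := integral_nonneg fun x => abs_nonneg _
  have hev : ∀ᶠ ε : ℝ in nhdsWithin 0 (Ioi 0), ε ∈ Ioo 0 (η / (2 * (A + 1))) :=
    Ioo_mem_nhdsGT (by positivity)
  filter_upwards [hev] with ε hε
  have hε0 := hε.1
  have hexp : IntegrableOn (fun x : ℝ => Real.exp (-ε * x)) (Ioi 0) := by
    simpa using integrableOn_exp_mul_Ioi (a := -ε) (by linarith) 0
  have hexpi : ∫ x in Ioi (0:ℝ), Real.exp (-ε * x) = 1 / ε := by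
    rw [integral_exp_mul_Ioi (by linarith) 0]; simp
  have e1 : ε * (∫ x in Ioi (0:ℝ), Real.exp (-ε * x) * T x) - a =
      ε * ∫ x in Ioi (0:ℝ), Real.exp (-ε * x) * (T x - a) := by
    simp_rw [mul_sub]
    rw [integral_sub (hT ε hε0) (hexp.mul_const a), integral_mul_const, hexpi]
    field_simp
  have i1 : Integrable ((Ioc 0 X).indicator (fun x => |T x - a|)) :=
    IntegrableOn.integrable_indicator (show IntegrableOn (fun x => |T x - a|) (Ioc 0 X) volume from hia.abs) measurableSet_Ioc
  have e2 : |∫ x in Ioi (0:ℝ), Real.exp (-ε * x) * (T x - a)| ≤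
      ∫ x in Ioi (0:ℝ), ((Ioc 0 X).indicator (fun x => |T x - a|) x + Real.exp (-ε * x) * (η / 2)) := by
    rw [← Real.norm_eq_abs]
    refine norm_integral_le_of_norm_le (i1.integrableOn.add (hexp.mul_const _)) ?_
    filter_upwards [ae_restrict_mem measurableSet_Ioi] with x hx
    have hx : 0 < x := hx
    rw [norm_mul, Real.norm_eq_abs, Real.norm_eq_abs, Real.abs_exp]
    have hp := Real.exp_pos (-ε * x)
    rcases le_or_gt x X with h | h
    · rw [indicator_of_mem (show x ∈ Ioc 0 X from ⟨hx, h⟩)]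
      have : Real.exp (-ε * x) ≤ 1 := by rw [Real.exp_le_one_iff]; nlinarith
      have : Real.exp (-ε * x) * |T x - a| ≤ |T x - a| := mul_le_of_le_one_left (abs_nonneg _) this
      have : 0 ≤ Real.exp (-ε * x) * (η / 2) := by positivity
      linarith
    · have h1 : 0 ≤ (Ioc 0 X).indicator (fun x => |T x - a|) x :=
        indicator_nonneg (fun _ _ => abs_nonneg _) x
      have := mul_le_mul_of_nonneg_left (hX x h.le) hp.le
      linarith
  have l2 : ∫ x in Ioi (0:ℝ), (Ioc 0 X).indicator (fun x => |T x - a|) x = A := by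
    rw [setIntegral_indicator measurableSet_Ioc, inter_eq_self_of_subset_right
      (show Ioc 0 X ⊆ Ioi 0 from fun x hx => hx.1)]
  rw [integral_add i1.integrableOn (hexp.mul_const _), l2, integral_mul_const, hexpi] at e2
  rw [Real.dist_eq, e1, abs_mul, abs_of_pos hε0]
  have h3 : ε * |∫ x in Ioi (0:ℝ), Real.exp (-ε * x) * (T x - a)| ≤ ε * (A + 1 / ε * (η / 2)) := by gcongr
  have h4 : ε * (A + 1 / ε * (η / 2)) = ε * A + η / 2 := by field_simp
  have h5 : ε * (2 * (A + 1)) < η := by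
    have := hε.2
    rwa [lt_div_iff₀ (by positivity)] at this
  nlinarith

theorem wi_RL (F : ℝ → ℝ) (hF : IntegrableOn F (Ioi 0)) :
    Tendsto (fun y : ℝ => ∫ t in Ioi (0:ℝ), F t * Real.cos (y * t)) atTop (nhds 0) := by
  set G : ℝ → ℂ := fun t => (((Ioi (0:ℝ)).indicator F t : ℝ) : ℂ) with hG
  have hGi : Integrable G := (hF.integrable_indicator measurableSet_Ioi).ofReal
  have h1 := Real.tendsto_integral_exp_smul_cocompact G
  have h2 : Tendsto (fun y : ℝ => y / (2 * Real.pi)) atTop (cocompact ℝ) := by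
    refine Tendsto.mono_right ?_ atTop_le_cocompact
    exact tendsto_id.atTop_div_const (by positivity)
  have h3 := (Complex.continuous_re.tendsto _).comp (h1.comp h2)
  simp only [Complex.zero_re] at h3
  refine h3.congr fun y => ?_
  simp only [Function.comp]
  rw [← integral_indicator measurableSet_Ioi]
  have hi : Integrable (fun v : ℝ => (Real.fourierChar (-(v * (y / (2 * Real.pi)))) : Circle) • G v) := by
    refine hGi.mono ?_ ?_
    · have : Continuous fun v : ℝ => ((Real.fourierChar (-(v * (y / (2 * Real.pi)))) : Circle) : ℂ) := by
        have := Real.continuous_fourierChar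
        fun_prop
      exact this.aestronglyMeasurable.mul hGi.aestronglyMeasurable
    · filter_upwards with v
      rw [Circle.norm_smul]
  have := integral_re hi
  rw [RCLike.re_eq_complex_re] at this
  rw [← this]
  refine integral_congr_ae (Eventually.of_forall fun v => ?_)
  simp only [RCLike.re_eq_complex_re]
  rw [Circle.smul_def, Real.fourierChar_apply, smul_eq_mul, hG]
  simp only []
  rw [Complex.re_mul_ofReal, Complex.exp_ofReal_mul_I_re]
  have e : 2 * Real.pi * -(v * (y / (2 * Real.pi))) = -(y * v) := by
    field_simp
  rw [e, Real.cos_neg]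
  by_cases hv : v ∈ Ioi (0:ℝ)
  · simp [hv, indicator_of_mem, mul_comm]
  · simp [hv, indicator_of_notMem]

theorem wi_core (S : ℝ → ℝ)
    (hI : ∀ σ : ℝ, 1 < σ → IntegrableOn (fun x => Real.exp (-σ * x) * S x) (Ioi 0))
    (T : ℝ → ℝ) (hTS : ∀ x, T x = Real.exp (-x) * S x)
    (hloc : ∀ X, IntegrableOn T (Ioc 0 X))
    (x₀ M : ℝ) (hlowT : ∀ x, x₀ ≤ x → -M ≤ T x)
    (R y : ℝ) (hR : 0 < R) (l : ℝ)
    (hl : Tendsto (fun σ : ℝ => ∫ t in Ioi (0:ℝ),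
      (∫ x in Ioi (0:ℝ), Real.exp (-σ * x) * S x * Real.cos (t * x)) * (wiphi R t * Real.cos (y * t)))
      (nhdsWithin 1 (Ioi 1)) (nhds l)) :
    IntegrableOn (fun x => T x * wiK R y x) (Ioi 0) ∧ ∫ x in Ioi (0:ℝ), T x * wiK R y x = l := by
  have hχ : IntegrableOn (fun t => wiphi R t * Real.cos (y * t)) (Ioi 0) := by
    refine (wiphi_int R hR).mul_bdd (c := 1) (by fun_prop) ?_
    filter_upwards with t
    exact Real.abs_cos_le_one _
  have hexp : ∀ ε x : ℝ, Real.exp (-(1 + ε) * x) * S x = Real.exp (-ε * x) * T x := by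
    intro ε x
    rw [hTS, ← mul_assoc, ← Real.exp_add]; congr 2; ring
  have hTm : AEStronglyMeasurable T (volume.restrict (Ioi 0)) := by
    have h1 := (hI 2 (by norm_num)).aestronglyMeasurable
    have h2 : AEStronglyMeasurable (fun x : ℝ => Real.exp x) (volume.restrict (Ioi 0)) := by fun_prop
    refine (h2.mul h1).congr (Eventually.of_forall fun x => ?_)
    simp only [Pi.mul_apply]
    rw [hTS, ← mul_assoc, ← Real.exp_add]; congr 2; ring
  refine wi_fatou (fun x => T x * wiK R y x)
    (fun x => (Iic x₀).indicator T x * wiK R y x + -(|M| * wiK R y x)) l ?_ ?_ ?_ ?_ ?_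
  · intro ε hε
    have h1 := hI (1 + ε) (by linarith)
    have h2 : IntegrableOn (fun x => (Real.exp (-(1 + ε) * x) * S x) * wiK R y x) (Ioi 0) := by
      refine h1.mul_bdd (c := R / 2) (wiK_cont R y).aestronglyMeasurable ?_
      filter_upwards with x
      rw [Real.norm_eq_abs, abs_of_nonneg (wiK_nonneg R y x hR)]
      exact wiK_le R y x hR
    refine h2.congr (Eventually.of_forall fun x => ?_)
    simp only [hexp, mul_assoc]
  · exact hTm.mul (wiK_cont R y).aestronglyMeasurable
  · refine Integrable.add ?_ ((wiK_int R y hR).const_mul |M|).neg.integrableOn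
    have h1 : IntegrableOn ((Iic x₀).indicator T) (Ioi 0) := by
      rw [IntegrableOn, integrable_indicator_iff measurableSet_Iic, IntegrableOn,
        Measure.restrict_restrict measurableSet_Iic, inter_comm, Ioi_inter_Iic]
      exact hloc x₀
    refine h1.mul_bdd (c := R / 2) (wiK_cont R y).aestronglyMeasurable ?_
    filter_upwards with x
    rw [Real.norm_eq_abs, abs_of_nonneg (wiK_nonneg R y x hR)]
    exact wiK_le R y x hR
  · intro x hx
    have hK := wiK_nonneg R y x hR
    rcases le_or_gt x x₀ with h | h
    · rw [indicator_of_mem (show x ∈ Iic x₀ from h)]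
      have : 0 ≤ |M| * wiK R y x := by positivity
      linarith
    · rw [indicator_of_notMem (show x ∉ Iic x₀ from not_le.2 h)]
      have h1 := hlowT x h.le
      have h2 := le_abs_self M
      have : 0 ≤ (T x + |M|) * wiK R y x := mul_nonneg (by linarith) hK
      linarith
  · have hshift : Tendsto (fun ε : ℝ => 1 + ε) (nhdsWithin 0 (Ioi 0)) (nhdsWithin 1 (Ioi 1)) := by
      refine tendsto_nhdsWithin_iff.2 ⟨?_, ?_⟩
      · have : Tendsto (fun ε : ℝ => 1 + ε) (nhds 0) (nhds (1 + 0)) := (continuous_const.add continuous_id).tendsto 0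
        rw [add_zero] at this
        exact this.mono_left nhdsWithin_le_nhds
      · filter_upwards [self_mem_nhdsWithin] with ε hε
        have : (0:ℝ) < ε := hε
        show (1:ℝ) < 1 + ε
        linarith
    refine (hl.comp hshift).congr' ?_
    filter_upwards [self_mem_nhdsWithin] with ε hε
    have hε : (0:ℝ) < ε := hε
    simp only [Function.comp]
    rw [wi_fubini (volume.restrict (Ioi 0)) (volume.restrict (Ioi 0))
      (fun x => Real.exp (-(1 + ε) * x) * S x) (fun t => wiphi R t * Real.cos (y * t))
      (hI (1 + ε) (by linarith)) hχ]
    refine integral_congr_ae (Eventually.of_forall fun x => ?_)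
    simp only []
    rw [wiK_formula R y x hR, hexp, mul_assoc]

theorem wi_real (S : ℝ → ℝ)
    (hslow : ∀ ε : ℝ, 0 < ε → ∃ h : ℝ, 0 < h ∧ ∃ x₀ : ℝ, 0 < x₀ ∧ ∀ x y : ℝ,
      x₀ ≤ x → x ≤ y → y ≤ x + h → (S y - S x) / Real.exp x ≥ -ε)
    (hI : ∀ σ : ℝ, 1 < σ → IntegrableOn (fun x => Real.exp (-σ * x) * S x) (Ioi 0))
    (u : ℝ → ℝ → ℝ)
    (hu : ∀ σ t, u σ t = ∫ x in Ioi (0:ℝ), Real.exp (-σ * x) * S x * Real.cos (t * x))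
    (f : ℝ → ℝ) (hf : ∀ a b : ℝ, 0 < a → a ≤ b → IntegrableOn f (Icc a b) ∧
      Tendsto (fun σ => ∫ t in a..b, |u σ t - f t|) (nhdsWithin 1 (Ioi 1)) (nhds 0))
    (lam : ℝ) (hlam : 0 < lam)
    (g : ℝ → ℝ) (hg : IntegrableOn g (Ioo (-lam) lam))
    (k : ℕ) (C : ℝ) (hC : 0 < C)
    (hlow : ∀ σ ∈ Ioc (1 : ℝ) 2, ∀ᵐ t ∂(volume.restrict (Ioo (-lam) lam)), g t ≤ u σ t)
    (hgrow : ∀ t ∈ Ioo (-lam) lam, ∀ σ ∈ Ioc (1 : ℝ) 2, |u σ t| ≤ C / (σ - 1) ^ k) :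
    ∃ a : ℝ,
      Tendsto (fun σ : ℝ => (σ - 1) * u σ 0) (nhdsWithin 1 (Ioi 1)) (nhds a) ∧
      Tendsto (fun x : ℝ => Real.exp (-x) * S x) atTop (nhds a) := by
  have hu' : u = fun σ t => ∫ x in Ioi (0:ℝ), Real.exp (-σ * x) * S x * Real.cos (t * x) := by
    ext σ t; exact hu σ t
  have hucont : ∀ σ, 1 < σ → Continuous (u σ) := by
    intro σ hσ
    have := wi_phi_cont (fun x => Real.exp (-σ * x) * S x) (volume.restrict (Ioi 0)) (hI σ hσ)
    rw [hu']
    simpa only [mul_comm] using this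
  have heven : ∀ σ t, u σ (-t) = u σ t := by
    intro σ t
    simp only [hu, neg_mul, Real.cos_neg]
  let b : ContDiffBump (0:ℝ) := ⟨lam / 4, lam / 2, by positivity, by linarith⟩
  have hbs : tsupport b ⊆ Ioo (-lam) lam := by
    rw [b.tsupport_eq]
    intro t ht
    rw [mem_closedBall_zero_iff, Real.norm_eq_abs, abs_le] at ht
    have : b.rOut = lam / 2 := rfl
    rw [this] at ht
    exact ⟨by linarith [ht.1], by linarith [ht.2]⟩
  obtain ⟨m, hm⟩ := wi_Fconv S hI lam k C hC (by simpa only [hu] using hgrow) b b.contDiff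
    b.hasCompactSupport hbs
  obtain ⟨c, hfi, hc⟩ := wi_B u hucont heven f hf lam (lam / 4) (by positivity) (by linarith) g hg hlow
    b b.continuous (fun t => b.nonneg) (fun t => b.le_one) (fun t => b.neg t) (fun t ht => by
      refine b.one_of_mem_closedBall ?_
      rw [mem_closedBall_zero_iff, Real.norm_eq_abs]
      exact ht) (fun t ht => by
      by_contra hne
      exact ht (hbs (subset_tsupport _ hne))) m (by simpa only [hu] using hm)
  set T : ℝ → ℝ := fun x => Real.exp (-x) * S x with hT
  have hTS : ∀ x, T x = Real.exp (-x) * S x := fun x => rfl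
  have hexp : ∀ ε x : ℝ, Real.exp (-(1 + ε) * x) * S x = Real.exp (-ε * x) * T x := by
    intro ε x
    rw [hTS, ← mul_assoc, ← Real.exp_add]; congr 2; ring
  have hTε : ∀ ε : ℝ, 0 < ε → IntegrableOn (fun x => Real.exp (-ε * x) * T x) (Ioi 0) := by
    intro ε hε
    have := hI (1 + ε) (by linarith)
    simpa only [hexp] using this
  have hloc : ∀ X, IntegrableOn T (Ioc 0 X) := by
    intro X
    have h1 : IntegrableOn (fun x => Real.exp (-1 * x) * T x) (Ioc 0 X) :=
      (hTε 1 one_pos).mono_set Ioc_subset_Ioi_self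
    have h2 : IntegrableOn (fun x => (Real.exp (-1 * x) * T x) * Real.exp x) (Ioc 0 X) := by
      refine Integrable.mul_bdd (c := Real.exp X) h1 (by fun_prop) ?_
      filter_upwards [ae_restrict_mem measurableSet_Ioc] with x hx
      rw [Real.norm_eq_abs, Real.abs_exp]
      exact Real.exp_le_exp.2 hx.2
    refine h2.congr (Eventually.of_forall fun x => ?_)
    have : Real.exp (-1 * x) * Real.exp x = 1 := by rw [← Real.exp_add]; simp
    simp only []
    linear_combination T x * this
  obtain ⟨h0, hh0, x₀, hx₀, H0⟩ := hslow 1 one_pos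
  obtain ⟨D, hD0, hD⟩ := wi_slow S h0 x₀ hh0 H0
  have hlowT : ∀ y, x₀ ≤ y → -(|S x₀| + D) ≤ T y := by
    intro y hy
    have a1 := hD x₀ y le_rfl hy
    have a2 := Real.exp_pos (-y)
    have a3 : Real.exp (-y) * Real.exp y = 1 := by rw [← Real.exp_add]; simp
    have a5 : Real.exp (-y) ≤ 1 := by rw [Real.exp_le_one_iff]; linarith
    have a6 : Real.exp (-y) * |S x₀| ≤ |S x₀| := mul_le_of_le_one_left (abs_nonneg _) a5
    have a7 : Real.exp (-y) * -|S x₀| ≤ Real.exp (-y) * S x₀ :=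
      mul_le_mul_of_nonneg_left (neg_abs_le _) a2.le
    have a8 := mul_le_mul_of_nonneg_left a1 a2.le
    have a9 : Real.exp (-y) * (S x₀ - D * Real.exp y) = Real.exp (-y) * S x₀ - D := by
      linear_combination (-D) * a3
    rw [hTS]
    linarith
  have hmain : ∀ R y : ℝ, 0 < R → IntegrableOn (fun x => T x * wiK R y x) (Ioi 0) ∧
      ∫ x in Ioi (0:ℝ), T x * wiK R y x =
        c + ∫ t in Ioi (0:ℝ), (f t * wiphi R t) * Real.cos (y * t) := by
    intro R y hR
    have h1 := hc (fun t => wiphi R t * Real.cos (y * t)) R ((wiphi_cont R).mul (by fun_prop))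
      (fun t ht => by rw [wiphi_zero R t hR ht, zero_mul])
    simp only [wiphi_at_zero, mul_zero, Real.cos_zero, mul_one] at h1
    simp only [hu] at h1
    have h2 := wi_core S hI T hTS hloc x₀ _ hlowT R y hR _ h1
    simpa only [mul_assoc] using h2
  have hlim : ∀ R : ℝ, 0 < R → Tendsto (fun y => ∫ x in Ioi (0:ℝ), T x * wiK R y x) atTop (nhds c) := by
    intro R hR
    have hF : IntegrableOn (fun t => f t * wiphi R t) (Ioi 0) := by
      have h1 : IntegrableOn (fun t => f t * wiphi R t) (Ioc 0 R) := by
        refine Integrable.mul_bdd (c := 1) (hfi R) (wiphi_cont R).aestronglyMeasurable ?_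
        filter_upwards [ae_restrict_mem measurableSet_Ioc] with t ht
        have : 0 ≤ t / R := div_nonneg ht.1.le hR.le
        rw [Real.norm_eq_abs, abs_of_nonneg (by unfold wiphi; exact le_max_left _ _)]
        unfold wiphi
        exact max_le zero_le_one (by linarith)
      refine h1.of_forall_sdiff_eq_zero measurableSet_Ioi ?_
      intro t ht
      have h3 : R < t := by
        by_contra hcon
        exact ht.2 ⟨ht.1, not_lt.1 hcon⟩
      rw [wiphi_zero R t hR h3.le, mul_zero]
    have h2 := (wi_RL _ hF).const_add c
    rw [add_zero] at h2
    exact h2.congr fun y => ((hmain R y hR).2).symm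
  have hTlim := wi_taub S T hTS hloc hslow c (fun R y hR => (hmain R y hR).1) hlim
  refine ⟨_, ?_, hTlim⟩
  have hab := wi_abel T _ hTε hloc hTlim
  have hshift : Tendsto (fun σ : ℝ => σ - 1) (nhdsWithin 1 (Ioi 1)) (nhdsWithin 0 (Ioi 0)) := by
    refine tendsto_nhdsWithin_iff.2 ⟨?_, ?_⟩
    · have : Tendsto (fun ε : ℝ => ε - 1) (nhds 1) (nhds (1 - 1)) :=
        (continuous_id.sub continuous_const).tendsto 1
      rw [sub_self] at this
      exact this.mono_left nhdsWithin_le_nhds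
    · filter_upwards [self_mem_nhdsWithin] with ε hε
      have : (1:ℝ) < ε := hε
      show (0:ℝ) < ε - 1
      linarith
  refine (hab.comp hshift).congr fun σ => ?_
  simp only [Function.comp]
  rw [hu]
  congr 1
  refine integral_congr_ae (Eventually.of_forall fun x => ?_)
  simp only [zero_mul, Real.cos_zero, mul_one]
  rw [← hexp]
  congr 3
  ring

/-- Theorem 1.2 (B.3): Wiener–Ikehara theorem with an `L¹` lower bound and a
polynomial growth bound on the real part of the Laplace transform near `s = 1`. -/
theorem wiener_ikehara_B3 (S : ℝ → ℝ)
    (hS : LocallyIntegrableOn S (Ici 0))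
    (hslow : LogLinSlowlyDecreasing S)
    (hconv : ∀ s : ℂ, 1 < s.re →
      IntegrableOn (fun x : ℝ => Complex.exp (-s * x) * (S x : ℂ)) (Ioi 0))
    (U : ℂ → ℝ) (hU : ∀ s : ℂ, U s = (laplaceT S s).re)
    (hbd : L1locBoundaryBehavior U)
    (lam : ℝ) (hlam : 0 < lam)
    (g : ℝ → ℝ) (hg : IntegrableOn g (Ioo (-lam) lam))
    (k : ℕ) (C : ℝ) (hC : 0 < C)
    (hlow : ∀ σ ∈ Ioc (1 : ℝ) 2, ∀ᵐ t ∂(volume.restrict (Ioo (-lam) lam)),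
      g t ≤ U (σ + t * Complex.I))
    (hgrow : ∀ t ∈ Ioo (-lam) lam, ∀ σ ∈ Ioc (1 : ℝ) 2,
      |U (σ + t * Complex.I)| ≤ C / (σ - 1) ^ k) :
    ∃ a : ℝ,
      Tendsto (fun σ : ℝ => (σ - 1) * U σ) (nhdsWithin 1 (Ioi 1)) (nhds a) ∧
      Tendsto (fun x : ℝ => Real.exp (-x) * S x) atTop (nhds a) := by
  have hreal : ∀ (σ t : ℝ) (x : ℝ), (Complex.exp (-(σ + t * Complex.I) * x) * (S x : ℂ)).re =
      Real.exp (-σ * x) * S x * Real.cos (t * x) := by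
    intro σ t x
    rw [Complex.re_mul_ofReal, Complex.exp_re]
    have h1 : (-(σ + t * Complex.I) * (x:ℂ)).re = -σ * x := by simp
    have h2 : (-(σ + t * Complex.I) * (x:ℂ)).im = -(t * x) := by simp
    rw [h1, h2, Real.cos_neg]; ring
  have hI : ∀ σ : ℝ, 1 < σ → IntegrableOn (fun x => Real.exp (-σ * x) * S x) (Ioi 0) := by
    intro σ hσ
    have h1 := (hconv (σ + (0:ℝ) * Complex.I) (by simpa using hσ)).re
    refine h1.congr (Eventually.of_forall fun x => ?_)
    simp only [RCLike.re_eq_complex_re]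
    rw [hreal]; simp
  set u : ℝ → ℝ → ℝ := fun σ t =>
    ∫ x in Ioi (0:ℝ), Real.exp (-σ * x) * S x * Real.cos (t * x) with hu
  have hUu : ∀ σ t : ℝ, 1 < σ → U (σ + t * Complex.I) = u σ t := by
    intro σ t hσ
    rw [hU, laplaceT]
    have h1 := integral_re (hconv (σ + t * Complex.I) (by simpa using hσ))
    simp only [RCLike.re_eq_complex_re, hreal] at h1
    exact h1.symm
  obtain ⟨f, hf⟩ := hbd
  obtain ⟨a, h1, h2⟩ := wi_real S hslow hI u (fun σ t => rfl) f (by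
    intro a b ha hab
    obtain ⟨h1, h2⟩ := hf a b hab (fun h => absurd h.1 (not_le.2 ha))
    refine ⟨h1, h2.congr' ?_⟩
    filter_upwards [self_mem_nhdsWithin] with σ hσ
    simp only [hUu σ _ hσ]) lam hlam g hg k C hC (by
    intro σ hσ
    filter_upwards [hlow σ hσ] with t ht
    rwa [hUu σ t hσ.1] at ht) (by
    intro t ht σ hσ
    have := hgrow t ht σ hσ
    rwa [hUu σ t hσ.1] at this)
  refine ⟨a, h1.congr' ?_, h2⟩
  filter_upwards [self_mem_nhdsWithin] with σ hσ
  rw [← hUu σ 0 hσ]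
  simp
end

section
/- (Koga's theorem.) Let S ∈ L¹_loc[0,∞) be log-linearly slowly decreasing and satisfy ∫₁^∞ |S(x)|/(x² e^x) dx < ∞, and set U(s) = Re 𝓛{S;s} where 𝓛{S;s} = ∫₀^∞ e^{−sx} S(x) dx (which converges for Re s > 1 by the integral condition). Assume there exist λ > 0 and g ∈ L¹(−λ,λ) such that U(σ+it) ≥ g(t) for a.e. t ∈ (−λ,λ) and all σ ∈ (1,2], and assume U has L¹_loc-boundary behavior on 1 + i(ℝ∖{0}). Then there exists a constant a ∈ ℝ such that S(x) ∼ a e^x as x → ∞, i.e. lim_{x→∞} e^{−x} S(x) = a. -/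
open MeasureTheory Filter Set

/-- Fejer kernel on the half line -/
noncomputable def kq (N u : ℝ) : ℝ := (1 - Real.cos (N * u)) / (N * u ^ 2)

lemma kq_nonneg {N : ℝ} (hN : 0 < N) (u : ℝ) : 0 ≤ kq N u := by
  unfold kq
  have := Real.cos_le_one (N * u)
  apply div_nonneg (by linarith) (by positivity)

lemma kq_le_const {N : ℝ} (hN : 0 < N) (u : ℝ) : kq N u ≤ N / 2 := by
  unfold kq
  rcases eq_or_ne u 0 with rfl | hu
  · simp; positivity
  · rw [div_le_iff₀ (by positivity)]
    have := Real.one_sub_sq_div_two_le_cos (x := N * u)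
    nlinarith

lemma kq_sq_le {N : ℝ} (hN : 0 < N) (u : ℝ) : u ^ 2 * kq N u ≤ 2 / N := by
  unfold kq
  rcases eq_or_ne u 0 with rfl | hu
  · simp; positivity
  · have := Real.neg_one_le_cos (N * u)
    rw [show u ^ 2 * ((1 - Real.cos (N * u)) / (N * u ^ 2)) = (1 - Real.cos (N * u)) / N by
      field_simp]
    gcongr
    linarith

lemma kq_measurable (N : ℝ) : Measurable (kq N) := by
  unfold kq
  fun_prop

lemma kq_le {N : ℝ} (hN : 0 < N) (u : ℝ) : kq N u ≤ (N / 2 + 2 / N) * (1 + u ^ 2)⁻¹ := by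
  rw [← div_eq_mul_inv, le_div_iff₀ (by positivity)]
  have := kq_le_const hN u
  have := kq_sq_le hN u
  nlinarith

lemma kq_integrable {N : ℝ} (hN : 0 < N) : Integrable (kq N) := by
  apply Integrable.mono' (integrable_inv_one_add_sq.const_mul (N / 2 + 2 / N))
    (kq_measurable N).aestronglyMeasurable
  refine Eventually.of_forall fun u => ?_
  rw [Real.norm_eq_abs, abs_of_nonneg (kq_nonneg hN u)]
  exact kq_le hN u

lemma kq_scale {N : ℝ} (hN : 0 < N) (u : ℝ) : kq N u = N * kq 1 (N * u) := by
  unfold kq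
  rcases eq_or_ne u 0 with rfl | hu
  · simp
  · simp only [one_mul]; field_simp

noncomputable def kap : ℝ := ∫ u, kq 1 u

lemma kq_integral {N : ℝ} (hN : 0 < N) : ∫ u, kq N u = kap := by
  simp_rw [kq_scale hN]
  rw [integral_const_mul, Measure.integral_comp_mul_left (fun u => kq 1 u), kap,
    abs_of_pos (by positivity), smul_eq_mul]
  field_simp

lemma kap_pos : 0 < kap := by
  have h1 : (∫ u in Icc (1:ℝ) 2, (1 - Real.cos 1) / 4) ≤ ∫ u in Icc (1:ℝ) 2, kq 1 u := by
    apply setIntegral_mono_on (by simp) (kq_integrable one_pos).integrableOn measurableSet_Icc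
    intro u hu
    unfold kq
    simp only [one_mul]
    have hc : Real.cos u ≤ Real.cos 1 := by
      apply Real.cos_le_cos_of_nonneg_of_le_pi (by norm_num) _ hu.1
      linarith [Real.pi_gt_three, hu.2]
    have h2 : 0 < 1 - Real.cos 1 := by linarith [Real.cos_one_le]
    have hu1 := hu.1
    have hu2 := hu.2
    apply div_le_div₀ (by linarith) (by linarith) (by positivity)
    nlinarith
  have h2 : (∫ u in Icc (1:ℝ) 2, kq 1 u) ≤ kap :=
    setIntegral_le_integral (kq_integrable one_pos) (Eventually.of_forall (kq_nonneg one_pos))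
  have h3 : 0 < 1 - Real.cos 1 := by linarith [Real.cos_one_le]
  have h4 : 0 < ∫ u in Icc (1:ℝ) 2, (1 - Real.cos 1) / 4 := by
    simp; linarith
  linarith

lemma kq_tendsto_kap {h : ℝ} (hh : 0 < h) :
    Tendsto (fun N : ℝ => ∫ u in (-h)..h, kq N u) atTop (nhds kap) := by
  have : Tendsto (fun N : ℝ => ∫ u in (N * (-h))..(N * h), kq 1 u) atTop (nhds kap) := by
    apply intervalIntegral_tendsto_integral (kq_integrable one_pos)
    · exact tendsto_id.atTop_mul_const_of_neg (by linarith)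
    · exact tendsto_id.atTop_mul_const hh
  apply this.congr'
  filter_upwards [eventually_gt_atTop 0] with N hN
  simp_rw [kq_scale hN]
  rw [intervalIntegral.integral_const_mul, intervalIntegral.integral_comp_mul_left _ hN.ne']
  rw [smul_eq_mul]; field_simp

lemma kq_int_cos {N u : ℝ} (hN : 0 < N) (hu : u ≠ 0) :
    ∫ t in (0:ℝ)..N, (1 - t / N) * Real.cos (t * u) = kq N u := by
  have hd : ∀ t ∈ uIcc (0:ℝ) N, HasDerivAt
      (fun t : ℝ => (1 - t / N) * (Real.sin (t * u) / u) - Real.cos (t * u) / (N * u ^ 2))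
      ((1 - t / N) * Real.cos (t * u)) t := by
    intro t _
    have h1 : HasDerivAt (fun t : ℝ => t * u) u t := by simpa using (hasDerivAt_id t).mul_const u
    have h2 : HasDerivAt (fun t : ℝ => 1 - t / N) (-(1 / N)) t := by
      simpa using ((hasDerivAt_id t).div_const N).const_sub 1
    have := (h2.mul (h1.sin.div_const u)).sub (h1.cos.div_const (N * u ^ 2))
    refine this.congr_deriv ?_
    field_simp
    ring
  rw [intervalIntegral.integral_eq_sub_of_hasDerivAt hd
    (Continuous.intervalIntegrable (by fun_prop) _ _)]
  unfold kq
  simp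
  field_simp
  ring

lemma kq_neg (N u : ℝ) : kq N (-u) = kq N u := by simp [kq]

lemma kq_int_cos2 {N x y : ℝ} (hN : 0 < N) (h1 : x + y ≠ 0) (h2 : x - y ≠ 0) :
    ∫ t in (0:ℝ)..N, (1 - t / N) * Real.cos (t * y) * Real.cos (t * x)
      = (kq N (x + y) + kq N (x - y)) / 2 := by
  rw [← kq_int_cos hN h1, ← kq_int_cos hN h2, ← intervalIntegral.integral_add
    (Continuous.intervalIntegrable (by fun_prop) _ _)
    (Continuous.intervalIntegrable (by fun_prop) _ _), ← intervalIntegral.integral_div]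
  congr 1
  ext t
  rw [mul_add, mul_sub, Real.cos_add, Real.cos_sub]
  ring

lemma kq_tendsto_zero {N : ℝ} (hN : 0 < N) {l : Filter ℝ} {φ : ℝ → ℝ}
    (h : Tendsto (fun y => (φ y) ^ 2) l atTop) : Tendsto (fun y => kq N (φ y)) l (nhds 0) := by
  apply squeeze_zero (g := fun y => (N / 2 + 2 / N) * (1 + φ y ^ 2)⁻¹)
    (fun y => kq_nonneg hN _) (fun y => kq_le hN _)
  have : Tendsto (fun y => (1 + φ y ^ 2)⁻¹) l (nhds 0) :=
    (tendsto_atTop_add_const_left l 1 h).inv_tendsto_atTop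
  simpa using this.const_mul (N / 2 + 2 / N)

lemma s_meas {s : ℝ → ℝ} (hW : IntegrableOn (fun x => s x * (1 + x ^ 2)⁻¹) (Ioi 0)) :
    AEStronglyMeasurable s (volume.restrict (Ioi 0)) := by
  have h1 : AEStronglyMeasurable (fun x : ℝ => 1 + x ^ 2) (volume.restrict (Ioi 0)) :=
    (by fun_prop : Continuous fun x : ℝ => 1 + x ^ 2).aestronglyMeasurable
  refine (hW.aestronglyMeasurable.mul h1).congr (Eventually.of_forall fun x => ?_)
  have : (1 + x ^ 2) ≠ 0 := by positivity
  simp only [Pi.mul_apply]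
  field_simp

lemma s_bound {s : ℝ → ℝ} {φ : ℝ → ℝ} {C x : ℝ} (hb : |φ x| ≤ C * (1 + x ^ 2)⁻¹) :
    ‖s x * φ x‖ ≤ C * ‖s x * (1 + x ^ 2)⁻¹‖ := by
  rw [norm_mul, norm_mul, Real.norm_eq_abs, Real.norm_eq_abs, Real.norm_eq_abs,
    abs_of_nonneg (by positivity : 0 ≤ (1 + x ^ 2)⁻¹)]
  calc |s x| * |φ x| ≤ |s x| * (C * (1 + x ^ 2)⁻¹) := by gcongr
    _ = _ := by ring

lemma s_mul_int {s : ℝ → ℝ} (hW : IntegrableOn (fun x => s x * (1 + x ^ 2)⁻¹) (Ioi 0))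
    {φ : ℝ → ℝ} (hφ : Measurable φ) {C : ℝ} (hb : ∀ x, 0 < x → |φ x| ≤ C * (1 + x ^ 2)⁻¹) :
    IntegrableOn (fun x => s x * φ x) (Ioi 0) := by
  apply Integrable.mono' (hW.norm.const_mul C) ((s_meas hW).mul hφ.aestronglyMeasurable)
  filter_upwards [ae_restrict_mem measurableSet_Ioi] with x hx
  exact s_bound (hb x hx)

lemma s_mul_tendsto {s : ℝ → ℝ} (hW : IntegrableOn (fun x => s x * (1 + x ^ 2)⁻¹) (Ioi 0))
    {l : Filter ℝ} [l.IsCountablyGenerated] {F : ℝ → ℝ → ℝ} {φ : ℝ → ℝ}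
    (hF : ∀ i, Measurable (F i)) {C : ℝ}
    (hb : ∀ᶠ i in l, ∀ x, 0 < x → |F i x| ≤ C * (1 + x ^ 2)⁻¹)
    (hlim : ∀ x, 0 < x → Tendsto (fun i => F i x) l (nhds (φ x))) :
    Tendsto (fun i => ∫ x in Ioi 0, s x * F i x) l (nhds (∫ x in Ioi 0, s x * φ x)) := by
  apply tendsto_integral_filter_of_dominated_convergence _ _ _ (hW.norm.const_mul C)
  · filter_upwards [ae_restrict_mem measurableSet_Ioi] with x hx
    exact (hlim x hx).const_mul _
  · exact Eventually.of_forall fun i => (s_meas hW).mul (hF i).aestronglyMeasurable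
  · filter_upwards [hb] with i hi
    filter_upwards [ae_restrict_mem measurableSet_Ioi] with x hx
    exact s_bound (hi x hx)

lemma exp_decay {d x : ℝ} (hd : 0 < d) (hx : 0 < x) :
    Real.exp (-(d * x)) ≤ (1 + 2 / d ^ 2) * (1 + x ^ 2)⁻¹ := by
  rw [← div_eq_mul_inv, le_div_iff₀ (by positivity), Real.exp_neg, inv_mul_le_iff₀ (by positivity)]
  have h := Real.quadratic_le_exp_of_nonneg (x := d * x) (by positivity)
  have h1 : 1 ≤ Real.exp (d * x) := Real.one_le_exp (by positivity)
  have h2 : x ^ 2 = (2 / d ^ 2) * ((d * x) ^ 2 / 2) := by field_simp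
  have h3 : (d * x) ^ 2 / 2 ≤ Real.exp (d * x) := by nlinarith [mul_pos hd hx]
  have h4 : x ^ 2 ≤ (2 / d ^ 2) * Real.exp (d * x) := by rw [h2]; gcongr
  nlinarith

/-- The real part of the Laplace transform -/
noncomputable def kV (s : ℝ → ℝ) (d t : ℝ) : ℝ :=
  ∫ x in Ioi 0, s x * (Real.exp (-(d * x)) * Real.cos (t * x))

lemma expcos_bound {d x : ℝ} (t : ℝ) (hd : 0 < d) (hx : 0 < x) :
    |Real.exp (-(d * x)) * Real.cos (t * x)| ≤ (1 + 2 / d ^ 2) * (1 + x ^ 2)⁻¹ := by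
  rw [abs_mul, abs_of_pos (Real.exp_pos _)]
  calc _ ≤ Real.exp (-(d * x)) * 1 := by gcongr; exact Real.abs_cos_le_one _
    _ ≤ _ := by rw [mul_one]; exact exp_decay hd hx

lemma kV_cont {s : ℝ → ℝ} (hW : IntegrableOn (fun x => s x * (1 + x ^ 2)⁻¹) (Ioi 0))
    {d : ℝ} (hd : 0 < d) : Continuous (kV s d) := by
  unfold kV
  apply continuous_of_dominated (bound := fun x => (1 + 2 / d ^ 2) * ‖s x * (1 + x ^ 2)⁻¹‖)
  · intro t
    exact (s_meas hW).mul (by fun_prop : Continuous fun x : ℝ =>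
      (Real.exp (-(d * x)) * Real.cos (t * x))).aestronglyMeasurable
  · intro t
    filter_upwards [ae_restrict_mem measurableSet_Ioi] with x hx
    exact s_bound (φ := fun x => Real.exp (-(d * x)) * Real.cos (t * x)) (expcos_bound t hd hx)
  · exact hW.norm.const_mul _
  · exact Eventually.of_forall fun x => by fun_prop

/-- symmetric kernel -/
noncomputable def kK (N y x : ℝ) : ℝ := (kq N (x + y) + kq N (x - y)) / 2

lemma kK_meas (N y : ℝ) : Measurable (kK N y) := by
  unfold kK
  have := kq_measurable N
  fun_prop

lemma kq_sub_bound {N : ℝ} (hN : 0 < N) (x y : ℝ) :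
    |kq N (x - y)| ≤ ((1 + 2 * y ^ 2) * (N / 2) + 4 / N) * (1 + x ^ 2)⁻¹ := by
  rw [abs_of_nonneg (kq_nonneg hN _), ← div_eq_mul_inv, le_div_iff₀ (by positivity)]
  have h1 := kq_le_const hN (x - y)
  have h2 := kq_sq_le hN (x - y)
  have h0 := kq_nonneg hN (x - y)
  have h3 : 1 + x ^ 2 ≤ (1 + 2 * y ^ 2) + 2 * (x - y) ^ 2 := by nlinarith [sq_nonneg (x - 2 * y)]
  calc kq N (x - y) * (1 + x ^ 2) ≤ kq N (x - y) * ((1 + 2 * y ^ 2) + 2 * (x - y) ^ 2) := by gcongr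
    _ = (1 + 2 * y ^ 2) * kq N (x - y) + 2 * ((x - y) ^ 2 * kq N (x - y)) := by ring
    _ ≤ (1 + 2 * y ^ 2) * (N / 2) + 2 * (2 / N) := by gcongr
    _ = _ := by ring

lemma kq_add_bound {N : ℝ} (hN : 0 < N) {x y : ℝ} (hx : 0 < x) (hy : 0 ≤ y) :
    |kq N (x + y)| ≤ (N / 2 + 2 / N) * (1 + x ^ 2)⁻¹ := by
  rw [abs_of_nonneg (kq_nonneg hN _)]
  refine (kq_le hN _).trans ?_
  gcongr
  linarith

lemma kK_bound {N : ℝ} (hN : 0 < N) (x y : ℝ) :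
    |kK N y x| ≤ ((1 + 2 * y ^ 2) * (N / 2) + 4 / N) * (1 + x ^ 2)⁻¹ := by
  have h1 := kq_sub_bound hN x y
  have h2 := kq_sub_bound hN x (-y)
  rw [sub_neg_eq_add, neg_sq] at h2
  unfold kK
  rw [abs_le] at *
  constructor <;> linarith [h1.1, h1.2, h2.1, h2.2]

lemma kV_fubini {s : ℝ → ℝ} (hW : IntegrableOn (fun x => s x * (1 + x ^ 2)⁻¹) (Ioi 0))
    {d N : ℝ} (hd : 0 < d) (hN : 0 < N) (y : ℝ) :
    ∫ t in (0:ℝ)..N, kV s d t * ((1 - t / N) * Real.cos (t * y)) =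
      ∫ x in Ioi 0, s x * (Real.exp (-(d * x)) * kK N y x) := by
  unfold kV
  simp_rw [← integral_mul_const]
  rw [intervalIntegral_integral_swap]
  · apply integral_congr_ae
    have h1 : ∀ᵐ x ∂(volume.restrict (Ioi (0:ℝ))), x ≠ y := ae_restrict_of_ae (Measure.ae_ne volume y)
    have h2 : ∀ᵐ x ∂(volume.restrict (Ioi (0:ℝ))), x ≠ -y := ae_restrict_of_ae (Measure.ae_ne volume (-y))
    filter_upwards [h1, h2] with x hx1 hx2
    rw [kK, ← kq_int_cos2 hN (fun h => hx2 (by linarith)) (sub_ne_zero.2 hx1), ← mul_assoc,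
      ← intervalIntegral.integral_const_mul]
    congr 1
    ext t
    ring
  · have h1 : Integrable (fun x => s x * Real.exp (-(d * x))) (volume.restrict (Ioi 0)) := by
      apply s_mul_int hW (by fun_prop) (C := 1 + 2 / d ^ 2)
      intro x hx
      rw [abs_of_pos (Real.exp_pos _)]
      exact exp_decay hd hx
    have h2 : Integrable (fun t : ℝ => (1 - t / N) * Real.cos (t * y))
        (volume.restrict (uIoc 0 N)) := by
      rw [uIoc_of_le hN.le]
      exact (by fun_prop : Continuous fun t : ℝ => (1 - t / N) * Real.cos (t * y)).integrableOn_Ioc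
    have h3 := h2.mul_prod h1
    have h4 := h3.bdd_mul (f := fun z : ℝ × ℝ => Real.cos (z.1 * z.2)) (c := 1)
      (by fun_prop : Continuous fun z : ℝ × ℝ => Real.cos (z.1 * z.2)).aestronglyMeasurable
      (Eventually.of_forall fun z => Real.abs_cos_le_one _)
    refine h4.congr (Eventually.of_forall fun z => ?_)
    simp only [Function.uncurry]
    ring

lemma kV_lim {s : ℝ → ℝ} (hW : IntegrableOn (fun x => s x * (1 + x ^ 2)⁻¹) (Ioi 0))
    {N : ℝ} (hN : 0 < N) (y : ℝ) :
    Tendsto (fun d => ∫ t in (0:ℝ)..N, kV s d t * ((1 - t / N) * Real.cos (t * y)))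
      (nhdsWithin 0 (Ioi 0)) (nhds (∫ x in Ioi 0, s x * kK N y x)) := by
  have : Tendsto (fun d => ∫ x in Ioi 0, s x * (Real.exp (-(d * x)) * kK N y x))
      (nhdsWithin 0 (Ioi 0)) (nhds (∫ x in Ioi 0, s x * kK N y x)) := by
    refine s_mul_tendsto hW (C := (1 + 2 * y ^ 2) * (N / 2) + 4 / N) ?_ ?_ ?_
    · intro d
      have := kK_meas N y
      fun_prop
    · filter_upwards [self_mem_nhdsWithin] with d hd x hx
      have hd : 0 < d := hd
      rw [abs_mul, abs_of_pos (Real.exp_pos _)]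
      calc _ ≤ 1 * |kK N y x| := by
            gcongr
            rw [Real.exp_le_one_iff]
            nlinarith [mul_pos hd hx]
        _ ≤ _ := by rw [one_mul]; exact kK_bound hN x y
    · intro x hx
      have hc : Continuous (fun d => Real.exp (-(d * x)) * kK N y x) := by fun_prop
      have := (hc.tendsto 0).mono_left (nhdsWithin_le_nhds (s := Ioi 0))
      simpa using this
  apply this.congr'
  filter_upwards [self_mem_nhdsWithin] with d hd
  rw [kV_fubini hW hd hN]

lemma kV_bdd {s : ℝ → ℝ} (hW : IntegrableOn (fun x => s x * (1 + x ^ 2)⁻¹) (Ioi 0))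
    {lam : ℝ} (hlam : 0 < lam) {g : ℝ → ℝ} (hg : IntegrableOn g (Ioc 0 lam))
    (hlow : ∀ d ∈ Ioc (0 : ℝ) 1, ∀ᵐ t ∂(volume.restrict (Ioc 0 lam)), g t ≤ kV s d t) :
    ∃ C, ∀ᶠ d in nhdsWithin 0 (Ioi 0), ∫ t in (0:ℝ)..(lam / 2), |kV s d t| ≤ C := by
  have hl := kV_lim hW hlam 0
  set I := ∫ x in Ioi 0, s x * kK lam 0 x
  refine ⟨2 * (I + 1) + 3 * ∫ t in Ioc 0 lam, |g t|, ?_⟩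
  filter_upwards [hl.eventually (gt_mem_nhds (lt_add_one I)), Ioc_mem_nhdsGT one_pos] with d hd hd1
  have hc := kV_cont hW hd1.1
  have i1 : IntegrableOn (fun t => kV s d t * ((1 - t / lam) * Real.cos (t * 0))) (Ioc 0 lam) :=
    (by fun_prop : Continuous _).integrableOn_Ioc
  calc ∫ t in (0:ℝ)..(lam / 2), |kV s d t|
      = ∫ t in Ioc 0 lam, (Ioc 0 (lam / 2)).indicator (fun t => |kV s d t|) t := by
        rw [intervalIntegral.integral_of_le (by linarith), integral_indicator measurableSet_Ioc,
          Measure.restrict_restrict measurableSet_Ioc]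
        congr 2
        rw [inter_eq_left.2]
        exact Ioc_subset_Ioc_right (by linarith)
    _ ≤ ∫ t in Ioc 0 lam, (2 * (kV s d t * ((1 - t / lam) * Real.cos (t * 0))) + 3 * |g t|) := by
        apply integral_mono_ae
        · exact (hc.abs.integrableOn_Ioc).indicator measurableSet_Ioc
        · exact (i1.const_mul 2).add (hg.abs.const_mul 3)
        · filter_upwards [hlow d hd1, ae_restrict_mem measurableSet_Ioc] with t ht ht1
          have h0 : 0 ≤ 1 - t / lam := by
            rw [sub_nonneg, div_le_one hlam]; exact ht1.2
          have h1 : 1 - t / lam ≤ 1 := by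
            have := div_pos ht1.1 hlam
            linarith
          have h2 := neg_abs_le (g t)
          have h3 := le_abs_self (g t)
          simp only [mul_zero, Real.cos_zero, mul_one]
          by_cases hm : t ∈ Ioc 0 (lam / 2)
          · rw [indicator_of_mem hm]
            have h4 : 1 / 2 ≤ 1 - t / lam := by
              have : t / lam ≤ 1 / 2 := by rw [div_le_iff₀ hlam]; linarith [hm.2]
              linarith
            have h5 : |kV s d t| ≤ (kV s d t - g t) + |g t| := by
              rw [abs_le]; constructor <;> linarith
            nlinarith
          · rw [indicator_of_notMem hm]
            nlinarith
    _ = 2 * (∫ t in (0:ℝ)..lam, kV s d t * ((1 - t / lam) * Real.cos (t * 0)))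
          + 3 * ∫ t in Ioc 0 lam, |g t| := by
        rw [integral_add (i1.const_mul 2) (hg.abs.const_mul 3), integral_const_mul,
          integral_const_mul, intervalIntegral.integral_of_le hlam.le]
    _ ≤ _ := by linarith

lemma kV_f_int {s : ℝ → ℝ} (hW : IntegrableOn (fun x => s x * (1 + x ^ 2)⁻¹) (Ioi 0))
    {r : ℝ} (hr : 0 < r) {C : ℝ}
    (hC : ∀ᶠ d in nhdsWithin 0 (Ioi 0), ∫ t in (0:ℝ)..r, |kV s d t| ≤ C)
    {f : ℝ → ℝ} (hf : ∀ a b : ℝ, 0 < a → a ≤ b → IntegrableOn f (Icc a b) ∧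
      Tendsto (fun d => ∫ t in a..b, |kV s d t - f t|) (nhdsWithin 0 (Ioi 0)) (nhds 0)) :
    IntegrableOn f (Ioc 0 r) := by
  refine integrableOn_Ioc_of_intervalIntegral_norm_bounded_left (I := C + 1)
    (l := atTop) (a := fun n : ℕ => r / ((n:ℝ) + 1)) ?_ ?_ ?_
  · intro n
    refine (hf _ r (by positivity) ?_).1.mono_set Ioc_subset_Icc_self
    apply div_le_self hr.le
    have : (0:ℝ) ≤ n := by positivity
    linarith
  · have := (tendsto_one_div_add_atTop_nhds_zero_nat (𝕜 := ℝ)).const_mul r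
    simpa [div_eq_mul_inv] using this
  · refine Eventually.of_forall fun n => ?_
    set a := r / ((n:ℝ) + 1) with ha
    have ha0 : 0 < a := by positivity
    have har : a ≤ r := by
      apply div_le_self hr.le
      have : (0:ℝ) ≤ n := by positivity
      linarith
    obtain ⟨h1, h2⟩ := hf a r ha0 har
    obtain ⟨d, hd1, hd2, hd3⟩ := (hC.and ((h2.eventually (gt_mem_nhds one_pos)).and
      self_mem_nhdsWithin)).exists
    have hd3 : 0 < d := hd3
    have hc := kV_cont hW hd3
    have i1 : IntervalIntegrable f volume a r := by
      rw [intervalIntegrable_iff_integrableOn_Icc_of_le har]; exact h1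
    have i2 : IntervalIntegrable (kV s d) volume a r := hc.intervalIntegrable _ _
    rw [← intervalIntegral.integral_of_le har]
    calc ∫ t in a..r, ‖f t‖ ≤ ∫ t in a..r, (|kV s d t| + |kV s d t - f t|) := by
          apply intervalIntegral.integral_mono_on har i1.norm (i2.abs.add (i2.sub i1).abs)
          intro t _
          rw [Real.norm_eq_abs]
          have := abs_sub (kV s d t) (kV s d t - f t)
          simpa using this
      _ = (∫ t in a..r, |kV s d t|) + ∫ t in a..r, |kV s d t - f t| :=
          intervalIntegral.integral_add i2.abs (i2.sub i1).abs
      _ ≤ C + 1 := by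
          have : ∫ t in a..r, |kV s d t| ≤ ∫ t in (0:ℝ)..r, |kV s d t| := by
            apply intervalIntegral.integral_mono_interval ha0.le har le_rfl
            · exact Eventually.of_forall fun t => abs_nonneg _
            · exact hc.abs.intervalIntegrable _ _
          linarith

lemma kV_psi {s : ℝ → ℝ} (hW : IntegrableOn (fun x => s x * (1 + x ^ 2)⁻¹) (Ioi 0))
    {r : ℝ} (hr : 0 < r) {C : ℝ}
    (hC : ∀ᶠ d in nhdsWithin 0 (Ioi 0), ∫ t in (0:ℝ)..r, |kV s d t| ≤ C)
    {f : ℝ → ℝ} (hf : ∀ a b : ℝ, 0 < a → a ≤ b → IntegrableOn f (Icc a b) ∧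
      Tendsto (fun d => ∫ t in a..b, |kV s d t - f t|) (nhdsWithin 0 (Ioi 0)) (nhds 0))
    (hfi : ∀ R, 0 < R → IntervalIntegrable f volume 0 R)
    {R : ℝ} (hR : 0 < R) {ψ : ℝ → ℝ} (hψ : Continuous ψ) (hψ0 : ψ 0 = 0)
    {B : ℝ} (hB : ∀ t ∈ Icc 0 R, |ψ t| ≤ B) :
    Tendsto (fun d => ∫ t in (0:ℝ)..R, (kV s d t - f t) * ψ t) (nhdsWithin 0 (Ioi 0)) (nhds 0) := by
  set D := C + ∫ t in (0:ℝ)..r, |f t| with hD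
  have hB0 : 0 ≤ B := (abs_nonneg _).trans (hB 0 ⟨le_rfl, hR.le⟩)
  rw [Metric.tendsto_nhds]
  intro η hη
  have hη1 : 0 < η / (2 * (|D| + 1)) := by positivity
  set η1 := η / (2 * (|D| + 1)) with hη1d
  obtain ⟨e0, he0, he1⟩ := Metric.continuousAt_iff.1 (hψ.continuousAt (x := 0)) η1 hη1
  set e := min (e0 / 2) (min r R) with he
  have hepos : 0 < e := by positivity
  have her : e ≤ r := (min_le_right _ _).trans (min_le_left _ _)
  have heR : e ≤ R := (min_le_right _ _).trans (min_le_right _ _)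
  have hee : e < e0 := lt_of_le_of_lt (min_le_left _ _) (by linarith)
  have hsmall : ∀ t ∈ Icc 0 e, |ψ t| ≤ η1 := by
    intro t ht
    have : dist t 0 < e0 := by
      rw [Real.dist_eq, sub_zero, abs_of_nonneg ht.1]; linarith [ht.2]
    have := he1 this
    rw [hψ0, Real.dist_eq, sub_zero] at this
    exact this.le
  have hη2 : 0 < η / (2 * (B + 1)) := by positivity
  obtain ⟨h1, h2⟩ := hf e R hepos heR
  filter_upwards [hC, h2.eventually (gt_mem_nhds hη2), self_mem_nhdsWithin] with d hd1 hd2 hd3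
  have hd3 : 0 < d := hd3
  have hc := kV_cont hW hd3
  have j1 : ∀ a b, IntervalIntegrable (kV s d) volume a b := fun a b => hc.intervalIntegrable _ _
  have hfi1 : IntervalIntegrable f volume e R := (hfi e hepos).symm.trans (hfi R hR)
  have k1 : IntervalIntegrable (fun t => kV s d t - f t) volume 0 e := (j1 _ _).sub (hfi e hepos)
  have k2 : IntervalIntegrable (fun t => kV s d t - f t) volume e R := (j1 _ _).sub hfi1
  have kr : IntervalIntegrable (fun t => kV s d t - f t) volume 0 r := (j1 _ _).sub (hfi r hr)
  rw [dist_zero_right, ← intervalIntegral.integral_add_adjacent_intervals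
    (k1.mul_continuousOn hψ.continuousOn) (k2.mul_continuousOn hψ.continuousOn)]
  have b1 : ‖∫ t in (0:ℝ)..e, (kV s d t - f t) * ψ t‖ ≤ η1 * D := by
    calc ‖∫ t in (0:ℝ)..e, (kV s d t - f t) * ψ t‖
        ≤ ∫ t in (0:ℝ)..e, η1 * |kV s d t - f t| := by
          apply intervalIntegral.norm_integral_le_of_norm_le hepos.le _ (k1.abs.const_mul _)
          refine Eventually.of_forall fun t ht => ?_
          rw [norm_mul, mul_comm, Real.norm_eq_abs, Real.norm_eq_abs]
          gcongr
          exact hsmall t ⟨ht.1.le, ht.2⟩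
      _ = η1 * ∫ t in (0:ℝ)..e, |kV s d t - f t| := by
          rw [intervalIntegral.integral_const_mul]
      _ ≤ η1 * ∫ t in (0:ℝ)..r, |kV s d t - f t| := by
          gcongr
          apply intervalIntegral.integral_mono_interval le_rfl hepos.le her
          · exact Eventually.of_forall fun t => abs_nonneg _
          · exact kr.abs
      _ ≤ η1 * ∫ t in (0:ℝ)..r, (|kV s d t| + |f t|) := by
          gcongr
          apply intervalIntegral.integral_mono_on hr.le kr.abs ((j1 _ _).abs.add (hfi r hr).abs)
          intro t _
          exact abs_sub _ _
      _ ≤ η1 * D := by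
          gcongr
          rw [intervalIntegral.integral_add (j1 _ _).abs (hfi r hr).abs]
          linarith
  have b2 : ‖∫ t in e..R, (kV s d t - f t) * ψ t‖ ≤ B * ∫ t in e..R, |kV s d t - f t| := by
    rw [← intervalIntegral.integral_const_mul]
    apply intervalIntegral.norm_integral_le_of_norm_le heR _ (k2.abs.const_mul _)
    refine Eventually.of_forall fun t ht => ?_
    rw [norm_mul, mul_comm, Real.norm_eq_abs, Real.norm_eq_abs]
    gcongr
    exact hB t ⟨hepos.le.trans ht.1.le, ht.2⟩
  have b3 : η1 * D < η / 2 := by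
    have : η1 * (|D| + 1) = η / 2 := by rw [hη1d]; field_simp
    nlinarith [le_abs_self D]
  have b4 : B * ∫ t in e..R, |kV s d t - f t| ≤ η / 2 := by
    have h5 : B * ∫ t in e..R, |kV s d t - f t| ≤ B * (η / (2 * (B + 1))) := by gcongr
    have h6 : (B + 1) * (η / (2 * (B + 1))) = η / 2 := by field_simp
    nlinarith
  refine lt_of_le_of_lt (norm_add_le _ _) ?_
  linarith

/-- test functions -/
noncomputable def kPhi (N y t : ℝ) : ℝ := max 0 (1 - t / N) * Real.cos (t * y)

lemma kPhi_cont (N y : ℝ) : Continuous (kPhi N y) := by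
  unfold kPhi
  fun_prop

lemma kPhi_bound {N t : ℝ} (hN : 0 < N) (y : ℝ) (ht : 0 ≤ t) : |kPhi N y t| ≤ 1 := by
  unfold kPhi
  rw [abs_mul, abs_of_nonneg (le_max_left _ _)]
  have h1 : max 0 (1 - t / N) ≤ 1 := by
    apply max_le zero_le_one
    have : 0 ≤ t / N := by positivity
    linarith
  exact mul_le_one₀ h1 (abs_nonneg _) (Real.abs_cos_le_one _)

lemma kPhi_int {N R : ℝ} (hN : 0 < N) (hNR : N ≤ R) (y : ℝ) {h : ℝ → ℝ}
    (hh : IntervalIntegrable h volume 0 R) :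
    ∫ t in (0:ℝ)..R, h t * kPhi N y t = ∫ t in (0:ℝ)..N, h t * ((1 - t / N) * Real.cos (t * y)) := by
  have hi : IntervalIntegrable (fun t => h t * kPhi N y t) volume 0 R :=
    hh.mul_continuousOn (kPhi_cont N y).continuousOn
  have m : N ∈ uIcc 0 R := by rw [uIcc_of_le (hN.le.trans hNR)]; exact ⟨hN.le, hNR⟩
  have hi1 := hi.mono_set (uIcc_subset_uIcc_left m)
  have hi2 := hi.mono_set (uIcc_subset_uIcc_right m)
  rw [← intervalIntegral.integral_add_adjacent_intervals hi1 hi2]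
  have e2 : ∫ t in N..R, h t * kPhi N y t = 0 := by
    rw [intervalIntegral.integral_congr (g := fun _ => 0)]
    · simp
    · intro t ht
      rw [uIcc_of_le hNR] at ht
      have : 1 - t / N ≤ 0 := by
        rw [sub_nonpos, one_le_div hN]; exact ht.1
      simp [kPhi, max_eq_left this]
  rw [e2, add_zero]
  apply intervalIntegral.integral_congr
  intro t ht
  rw [uIcc_of_le hN.le] at ht
  have : 0 ≤ 1 - t / N := by
    rw [sub_nonneg, div_le_one hN]; exact ht.2
  simp [kPhi, max_eq_right this]

lemma riemann_leb {h : ℝ → ℝ} {N : ℝ} (hN : 0 < N) (hh : IntervalIntegrable h volume 0 N) :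
    Tendsto (fun y => ∫ t in (0:ℝ)..N, h t * Real.cos (t * y)) atTop (nhds 0) := by
  have h1 := Real.tendsto_integral_exp_smul_cocompact
    (fun t => ((Ioc 0 N).indicator (fun t => (h t : ℂ)) t))
  have h2 : Tendsto (fun y : ℝ => y / (2 * Real.pi)) atTop (cocompact ℝ) :=
    (tendsto_id.atTop_div_const (by positivity)).mono_right atTop_le_cocompact
  have h3 := (Complex.continuous_re.tendsto _).comp (h1.comp h2)
  rw [Complex.zero_re] at h3
  refine h3.congr fun y => ?_
  simp only [Function.comp_apply]
  have hi : IntegrableOn (fun t => (h t : ℂ)) (Ioc 0 N) := by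
    rw [intervalIntegrable_iff_integrableOn_Ioc_of_le hN.le] at hh
    exact hh.ofReal
  rw [intervalIntegral.integral_of_le hN.le, ← integral_indicator measurableSet_Ioc]
  rw [← RCLike.re_eq_complex_re, ← integral_re]
  · congr 1
    ext t
    by_cases ht : t ∈ Ioc 0 N
    · simp only [indicator_of_mem ht, Circle.smul_def, Real.fourierChar_apply, smul_eq_mul,
        RCLike.re_eq_complex_re]
      rw [Complex.re_mul_ofReal, Complex.exp_ofReal_mul_I_re]
      rw [show 2 * Real.pi * -(t * (y / (2 * Real.pi))) = -(t * y) by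
        have := Real.pi_pos
        field_simp, Real.cos_neg]
      ring
    · simp [indicator_of_notMem ht]
  · have := (integrable_indicator_iff measurableSet_Ioc).2 hi
    refine (this.norm).mono' ?_ ?_
    · refine (Continuous.aestronglyMeasurable ?_).smul this.aestronglyMeasurable
      fun_prop
    · refine Eventually.of_forall fun t => ?_
      rw [Circle.norm_smul]

lemma kV_const {s : ℝ → ℝ} (hW : IntegrableOn (fun x => s x * (1 + x ^ 2)⁻¹) (Ioi 0))
    {r : ℝ} (hr : 0 < r) {C : ℝ}
    (hC : ∀ᶠ d in nhdsWithin 0 (Ioi 0), ∫ t in (0:ℝ)..r, |kV s d t| ≤ C)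
    {f : ℝ → ℝ} (hf : ∀ a b : ℝ, 0 < a → a ≤ b → IntegrableOn f (Icc a b) ∧
      Tendsto (fun d => ∫ t in a..b, |kV s d t - f t|) (nhdsWithin 0 (Ioi 0)) (nhds 0))
    (hfi : ∀ R, 0 < R → IntervalIntegrable f volume 0 R) {N : ℝ} (hN : 0 < N) (y : ℝ) :
    (∫ x in Ioi 0, s x * kK N y x) - (∫ t in (0:ℝ)..N, f t * ((1 - t / N) * Real.cos (t * y)))
    = (∫ x in Ioi 0, s x * kK 1 0 x)
      - (∫ t in (0:ℝ)..1, f t * ((1 - t / 1) * Real.cos (t * 0))) := by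
  set R := max N 1
  have hNR : N ≤ R := le_max_left _ _
  have h1R : 1 ≤ R := le_max_right _ _
  have hR : 0 < R := hN.trans_le hNR
  have h0 := kV_psi hW hr hC hf hfi hR (ψ := fun t => kPhi N y t - kPhi 1 0 t)
    ((kPhi_cont N y).sub (kPhi_cont 1 0)) (by simp [kPhi]) (B := 2) (by
      intro t ht
      have h1 := kPhi_bound hN y ht.1
      have h2 := kPhi_bound one_pos 0 ht.1
      have := abs_sub (kPhi N y t) (kPhi 1 0 t)
      linarith)
  have h1 := ((kV_lim hW hN y).sub_const (∫ t in (0:ℝ)..N, f t * ((1 - t / N) * Real.cos (t * y)))).sub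
    ((kV_lim hW one_pos 0).sub_const (∫ t in (0:ℝ)..1, f t * ((1 - t / 1) * Real.cos (t * 0))))
  have h2 := tendsto_nhds_unique h0 (h1.congr' ?_)
  · linarith
  · filter_upwards [self_mem_nhdsWithin] with d hd
    have hd : 0 < d := hd
    have hv : IntervalIntegrable (kV s d) volume 0 R := (kV_cont hW hd).intervalIntegrable _ _
    have hfR := hfi R hR
    have hm : ∀ h : ℝ → ℝ, IntervalIntegrable h volume 0 R → ∀ N y,
      IntervalIntegrable (fun t => h t * kPhi N y t) volume 0 R :=
        fun h hh N y => hh.mul_continuousOn (kPhi_cont N y).continuousOn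
    rw [← kPhi_int hN hNR y hv, ← kPhi_int hN hNR y hfR, ← kPhi_int one_pos h1R 0 hv,
      ← kPhi_int one_pos h1R 0 hfR, ← intervalIntegral.integral_sub (hm _ hv _ _) (hm _ hfR _ _),
      ← intervalIntegral.integral_sub (hm _ hv _ _) (hm _ hfR _ _),
      ← intervalIntegral.integral_sub ((hm _ hv _ _).sub (hm _ hfR _ _))
        ((hm _ hv _ _).sub (hm _ hfR _ _))]
    congr 1
    ext t
    ring

lemma partA {s : ℝ → ℝ} (hW : IntegrableOn (fun x => s x * (1 + x ^ 2)⁻¹) (Ioi 0))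
    {lam : ℝ} (hlam : 0 < lam) {g : ℝ → ℝ} (hg : IntegrableOn g (Ioc 0 lam))
    (hlow : ∀ d ∈ Ioc (0 : ℝ) 1, ∀ᵐ t ∂(volume.restrict (Ioc 0 lam)), g t ≤ kV s d t)
    {f : ℝ → ℝ} (hf : ∀ a b : ℝ, 0 < a → a ≤ b → IntegrableOn f (Icc a b) ∧
      Tendsto (fun d => ∫ t in a..b, |kV s d t - f t|) (nhdsWithin 0 (Ioi 0)) (nhds 0)) :
    ∃ c, ∀ N, 0 < N → Tendsto (fun y => ∫ x in Ioi 0, s x * kq N (x - y)) atTop (nhds c) := by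
  obtain ⟨C, hC⟩ := kV_bdd hW hlam hg hlow
  have hr : 0 < lam / 2 := by positivity
  have hf0 := kV_f_int hW hr hC hf
  have hfi : ∀ R, 0 < R → IntervalIntegrable f volume 0 R := by
    intro R hR
    rw [intervalIntegrable_iff_integrableOn_Ioc_of_le hR.le]
    refine (hf0.union (hf (lam / 2) (max (lam / 2) R) hr (le_max_left _ _)).1).mono_set ?_
    intro t ht
    by_cases h : t ≤ lam / 2
    · exact Or.inl ⟨ht.1, h⟩
    · exact Or.inr ⟨(not_le.1 h).le, ht.2.trans (le_max_right _ _)⟩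
  set c0 := (∫ x in Ioi 0, s x * kK 1 0 x)
      - (∫ t in (0:ℝ)..1, f t * ((1 - t / 1) * Real.cos (t * 0))) with hc0
  refine ⟨2 * c0, fun N hN => ?_⟩
  have h1 : Tendsto (fun y => ∫ t in (0:ℝ)..N, (f t * (1 - t / N)) * Real.cos (t * y))
      atTop (nhds 0) := by
    apply riemann_leb hN
    apply (hfi N hN).mul_continuousOn
    fun_prop
  have h2 : Tendsto (fun y => ∫ x in Ioi 0, s x * kq N (x + y)) atTop (nhds 0) := by
    have : Tendsto (fun y => ∫ x in Ioi 0, s x * kq N (x + y)) atTop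
        (nhds (∫ x in Ioi 0, s x * (fun _ : ℝ => (0:ℝ)) x)) := by
      refine s_mul_tendsto hW (C := N / 2 + 2 / N) ?_ ?_ ?_
      · intro y
        have := kq_measurable N
        fun_prop
      · filter_upwards [eventually_ge_atTop 0] with y hy x hx
        exact kq_add_bound hN hx hy
      · intro x hx
        apply kq_tendsto_zero hN
        exact (tendsto_pow_atTop two_ne_zero).comp (tendsto_atTop_add_const_left _ x tendsto_id)
    simpa using this
  have h3 := ((h1.const_add c0).const_mul 2).sub h2
  rw [add_zero, sub_zero] at h3
  refine h3.congr fun y => ?_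
  have h4 := kV_const hW hr hC hf hfi hN y
  rw [← hc0] at h4
  have i1 : IntegrableOn (fun x => s x * kq N (x - y)) (Ioi 0) :=
    s_mul_int hW (by have := kq_measurable N; fun_prop) (fun x _ => kq_sub_bound hN x y)
  have i2 : IntegrableOn (fun x => s x * kq N (x + y)) (Ioi 0) :=
    s_mul_int hW (by have := kq_measurable N; fun_prop) (fun x _ => by
      have := kq_sub_bound hN x (-y)
      rwa [sub_neg_eq_add] at this)
  have h5 : 2 * ∫ x in Ioi 0, s x * kK N y x =
      (∫ x in Ioi 0, s x * kq N (x + y)) + ∫ x in Ioi 0, s x * kq N (x - y) := by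
    rw [← integral_add i2 i1, ← integral_const_mul]
    congr 1
    ext x
    unfold kK
    ring
  simp_rw [mul_assoc]
  linarith

lemma kq_shift_int {N : ℝ} (hN : 0 < N) (y : ℝ) : Integrable (fun x => kq N (x - y)) :=
  (kq_integrable hN).comp_sub_right y

lemma kq_Ioi_tendsto {N : ℝ} (hN : 0 < N) (X : ℝ) :
    Tendsto (fun y => ∫ x in Ioi X, kq N (x - y)) atTop (nhds kap) := by
  have h1 : ∀ y, ∫ x in Ioi X, kq N (x - y) =
      ∫ u, (Ioi (X - y)).indicator (kq N) u := by
    intro y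
    rw [← integral_sub_right_eq_self ((Ioi (X - y)).indicator (kq N)) y, ← integral_indicator measurableSet_Ioi]
    congr 1
    ext x
    simp only [indicator, mem_Ioi, sub_lt_sub_iff_right]
  simp_rw [h1]
  rw [← kq_integral hN]
  apply tendsto_integral_filter_of_dominated_convergence (kq N)
  · exact Eventually.of_forall fun y =>
      ((kq_measurable N).indicator measurableSet_Ioi).aestronglyMeasurable
  · refine Eventually.of_forall fun y => Eventually.of_forall fun u => ?_
    rw [Real.norm_eq_abs]
    by_cases h : u ∈ Ioi (X - y)
    · rw [indicator_of_mem h, abs_of_nonneg (kq_nonneg hN u)]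
    · rw [indicator_of_notMem h, abs_zero]; exact kq_nonneg hN u
  · exact kq_integrable hN
  · refine Eventually.of_forall fun u => ?_
    apply tendsto_const_nhds.congr'
    filter_upwards [eventually_gt_atTop (X - u)] with y hy
    rw [indicator_of_mem]
    simp only [mem_Ioi]; linarith

lemma sT_int {s : ℝ → ℝ} (hW : IntegrableOn (fun x => s x * (1 + x ^ 2)⁻¹) (Ioi 0))
    {N : ℝ} (hN : 0 < N) (M : ℝ) {X : ℝ} (hX : 0 ≤ X) (y : ℝ) :
    IntegrableOn (fun x => (s x + M) * kq N (x - y)) (Ioi X) := by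
  have i1 : IntegrableOn (fun x => s x * kq N (x - y)) (Ioi 0) :=
    s_mul_int hW (by have := kq_measurable N; fun_prop) (fun x _ => kq_sub_bound hN x y)
  have := (i1.mono_set (Ioi_subset_Ioi hX)).add ((kq_shift_int hN y).integrableOn.const_mul M)
  refine this.congr (Eventually.of_forall fun x => ?_)
  simp only [Pi.add_apply]
  ring

lemma sT_tendsto {s : ℝ → ℝ} (hW : IntegrableOn (fun x => s x * (1 + x ^ 2)⁻¹) (Ioi 0))
    {N c : ℝ} (hN : 0 < N)
    (hc : Tendsto (fun y => ∫ x in Ioi 0, s x * kq N (x - y)) atTop (nhds c))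
    (M : ℝ) {X : ℝ} (hX : 0 ≤ X) :
    Tendsto (fun y => ∫ x in Ioi X, (s x + M) * kq N (x - y)) atTop (nhds (c + M * kap)) := by
  have i1 : ∀ y, IntegrableOn (fun x => s x * kq N (x - y)) (Ioi 0) := fun y =>
    s_mul_int hW (by have := kq_measurable N; fun_prop) (fun x _ => kq_sub_bound hN x y)
  have hm : ∀ y, Measurable ((Iic X).indicator (fun x => kq N (x - y))) := by
    intro y
    apply Measurable.indicator _ measurableSet_Iic
    have := kq_measurable N
    fun_prop
  have hb : ∀ y x, 0 < x → |(Iic X).indicator (fun x => kq N (x - y)) x| ≤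
      (N / 2 * (1 + X ^ 2)) * (1 + x ^ 2)⁻¹ := by
    intro y x hx
    by_cases h : x ∈ Iic X
    · rw [indicator_of_mem h, abs_of_nonneg (kq_nonneg hN _), ← div_eq_mul_inv,
        le_div_iff₀ (by positivity)]
      have h1 := kq_le_const hN (x - y)
      have h2 : x ≤ X := h
      gcongr
    · rw [indicator_of_notMem h, abs_zero]; positivity
  have h2 : Tendsto (fun y => ∫ x in Ioi 0, s x * (Iic X).indicator (fun x => kq N (x - y)) x) atTop
        (nhds (∫ x in Ioi 0, s x * (fun _ : ℝ => (0:ℝ)) x)) := by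
    refine s_mul_tendsto hW (C := N / 2 * (1 + X ^ 2)) hm (Eventually.of_forall hb) ?_
    intro x hx
    by_cases h : x ∈ Iic X
    · simp only [indicator_of_mem h]
      apply kq_tendsto_zero hN
      have : Tendsto (fun y : ℝ => (y - x) ^ 2) atTop atTop :=
        (tendsto_pow_atTop two_ne_zero).comp (tendsto_atTop_add_const_right _ (-x) tendsto_id)
      refine this.congr fun y => by ring
    · simp only [indicator_of_notMem h]; exact tendsto_const_nhds
  have h3 := (hc.sub h2).add ((kq_Ioi_tendsto hN X).const_mul M)
  simp only [mul_zero, integral_zero, sub_zero] at h3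
  refine h3.congr fun y => ?_
  rw [← integral_sub (i1 y) (s_mul_int hW (hm y) (hb y))]
  have e1 : ∫ x in Ioi 0, (s x * kq N (x - y) - s x * (Iic X).indicator (fun x => kq N (x - y)) x) =
      ∫ x in Ioi X, s x * kq N (x - y) := by
    rw [show Ioi X = Ioi 0 ∩ Ioi X by rw [inter_eq_right.2 (Ioi_subset_Ioi hX)],
      ← setIntegral_indicator measurableSet_Ioi]
    congr 1
    ext x
    by_cases h : x ≤ X
    · rw [indicator_of_mem (by exact h), indicator_of_notMem (by simpa using h), sub_self]
    · rw [indicator_of_notMem (by exact h), indicator_of_mem (by simpa using h), mul_zero, sub_zero]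
  rw [e1, ← integral_const_mul, ← integral_add ((i1 y).mono_set (Ioi_subset_Ioi hX))
    ((kq_shift_int hN y).integrableOn.const_mul M)]
  congr 1
  ext x
  ring

lemma kq_window {N r : ℝ} (hr : 0 < r) (y : ℝ) :
    ∫ x in Ioc (y - r) (y + r), kq N (x - y) = ∫ u in (-r)..r, kq N u := by
  rw [← intervalIntegral.integral_of_le (by linarith),
    intervalIntegral.integral_comp_sub_right (fun u => kq N u)]
  congr 1 <;> ring

lemma taub_upper {T : ℝ → ℝ} {Q x0 : ℝ} (hT0 : ∀ x, x0 ≤ x → 0 ≤ T x)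
    (hint : ∀ N, 0 < N → ∀ y, IntegrableOn (fun x => T x * kq N (x - y)) (Ioi x0))
    (hP : ∀ N, 0 < N → Tendsto (fun y => ∫ x in Ioi x0, T x * kq N (x - y)) atTop (nhds Q))
    (hslow : ∀ ε, 0 < ε → ∃ h, 0 < h ∧ ∃ x1, ∀ x y, x1 ≤ x → x ≤ y → y ≤ x + h →
      T x - ε ≤ Real.exp (y - x) * T y)
    {B : ℝ} (hB : Q / kap < B) : ∀ᶠ x in atTop, T x < B := by
  have hk := kap_pos
  set ε := (B - Q / kap) / 2 with hε
  have hε0 : 0 < ε := by rw [hε]; linarith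
  obtain ⟨h, hh, x1, hs⟩ := hslow ε hε0
  have hc : Tendsto (fun r : ℝ => Real.exp (2 * r) * (Q / kap)) (nhdsWithin 0 (Ioi 0))
      (nhds (Q / kap)) := by
    have : Continuous (fun r : ℝ => Real.exp (2 * r) * (Q / kap)) := by fun_prop
    have := (this.tendsto 0).mono_left (nhdsWithin_le_nhds (s := Ioi 0))
    simpa using this
  have hBε : Q / kap < B - ε := by rw [hε]; linarith
  obtain ⟨r, hr1, hr0, hrh⟩ := ((hc.eventually (gt_mem_nhds hBε)).and
    (Ioo_mem_nhdsGT (by positivity : 0 < h / 2))).exists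
  have hNl : Tendsto (fun N : ℝ => Real.exp (2 * r) * (Q / ∫ u in (-r)..r, kq N u)) atTop
      (nhds (Real.exp (2 * r) * (Q / kap))) :=
    (tendsto_const_nhds.div (kq_tendsto_kap hr0) (ne_of_gt hk)).const_mul _
  obtain ⟨N, hN1, hN2, hN⟩ := ((hNl.eventually (gt_mem_nhds hr1)).and
    (((kq_tendsto_kap hr0).eventually (lt_mem_nhds hk)).and (eventually_gt_atTop 0))).exists
  set κ := ∫ u in (-r)..r, kq N u with hκ
  have hPx : Tendsto (fun x => Real.exp (2 * r) *
      ((∫ z in Ioi x0, T z * kq N (z - (x + r))) / κ)) atTop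
      (nhds (Real.exp (2 * r) * (Q / κ))) :=
    (((hP N hN).comp (tendsto_atTop_add_const_right _ r tendsto_id)).div_const κ).const_mul _
  filter_upwards [hPx.eventually (gt_mem_nhds hN1), eventually_ge_atTop x0,
    eventually_ge_atTop x1] with x hx hx0 hx1
  set P := ∫ z in Ioi x0, T z * kq N (z - (x + r)) with hPdef
  have hpos : ∀ z ∈ Ioi x0, 0 ≤ T z * kq N (z - (x + r)) := fun z hz =>
    mul_nonneg (hT0 z (le_of_lt hz)) (kq_nonneg hN _)
  have hP0 : 0 ≤ P := setIntegral_nonneg measurableSet_Ioi hpos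
  suffices hsuf : T x ≤ ε + Real.exp (2 * r) * (P / κ) by linarith
  by_cases hTx : T x ≤ ε
  · have : 0 ≤ Real.exp (2 * r) * (P / κ) := by positivity
    linarith
  push Not at hTx
  have hsub : Ioc ((x + r) - r) ((x + r) + r) ⊆ Ioi x0 := by
    intro z hz
    have := hz.1
    simp only [mem_Ioi]; linarith
  have key : Real.exp (-(2 * r)) * (T x - ε) * κ ≤ P := by
    calc Real.exp (-(2 * r)) * (T x - ε) * κ
        = ∫ z in Ioc ((x + r) - r) ((x + r) + r), Real.exp (-(2 * r)) * (T x - ε) * kq N (z - (x + r)) := by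
          rw [integral_const_mul, kq_window hr0]
      _ ≤ ∫ z in Ioc ((x + r) - r) ((x + r) + r), T z * kq N (z - (x + r)) := by
          apply setIntegral_mono_on ((kq_shift_int hN _).integrableOn.const_mul _)
            ((hint N hN _).mono_set hsub) measurableSet_Ioc
          intro z hz
          apply mul_le_mul_of_nonneg_right _ (kq_nonneg hN _)
          have hz1 := hz.1
          have hz2 := hz.2
          have h1 := hs x z hx1 (by linarith) (by linarith)
          have h2 : T x - ε ≤ Real.exp (2 * r) * T z := by
            refine h1.trans ?_
            apply mul_le_mul_of_nonneg_right _ (hT0 z (by linarith))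
            apply Real.exp_le_exp.2
            linarith
          rw [Real.exp_neg, inv_mul_le_iff₀ (Real.exp_pos _)]
          exact h2
      _ ≤ P := by
          apply setIntegral_mono_set (hint N hN _) _ (Eventually.of_forall hsub)
          filter_upwards [ae_restrict_mem measurableSet_Ioi] with z hz using hpos z hz
  rw [Real.exp_neg, mul_assoc, inv_mul_le_iff₀ (Real.exp_pos _), ← le_div_iff₀ hN2, mul_div_assoc] at key
  linarith

lemma taub_lower {T : ℝ → ℝ} {Q x0 B0 : ℝ} (hT0 : ∀ x, x0 ≤ x → 0 ≤ T x)
    (hTB : ∀ x, x0 ≤ x → T x ≤ B0)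
    (hint : ∀ N, 0 < N → ∀ y, IntegrableOn (fun x => T x * kq N (x - y)) (Ioi x0))
    (hP : ∀ N, 0 < N → Tendsto (fun y => ∫ x in Ioi x0, T x * kq N (x - y)) atTop (nhds Q))
    (hslow : ∀ ε, 0 < ε → ∃ h, 0 < h ∧ ∃ x1, ∀ x y, x1 ≤ x → x ≤ y → y ≤ x + h →
      T x - ε ≤ Real.exp (y - x) * T y)
    {B : ℝ} (hB : B < Q / kap) : ∀ᶠ x in atTop, B < T x := by
  have hk := kap_pos
  have hB0 : 0 ≤ B0 := (hT0 x0 le_rfl).trans (hTB x0 le_rfl)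
  set ε := (Q / kap - B) / 2 with hε
  have hε0 : 0 < ε := by rw [hε]; linarith
  obtain ⟨h, hh, x1, hs⟩ := hslow ε hε0
  have hc : Tendsto (fun r : ℝ => Real.exp (-(2 * r)) * (Q / kap - ε)) (nhdsWithin 0 (Ioi 0))
      (nhds (Q / kap - ε)) := by
    have : Continuous (fun r : ℝ => Real.exp (-(2 * r)) * (Q / kap - ε)) := by fun_prop
    have := (this.tendsto 0).mono_left (nhdsWithin_le_nhds (s := Ioi 0))
    simpa using this
  have hBε : B < Q / kap - ε := by rw [hε]; linarith
  obtain ⟨r, hr1, hr0, hrh⟩ := ((hc.eventually (lt_mem_nhds hBε)).and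
    (Ioo_mem_nhdsGT (by positivity : 0 < h / 2))).exists
  have hNl : Tendsto (fun N : ℝ => Real.exp (-(2 * r)) *
      ((Q - B0 * (kap - ∫ u in (-r)..r, kq N u)) / kap - ε)) atTop
      (nhds (Real.exp (-(2 * r)) * ((Q - B0 * (kap - kap)) / kap - ε))) :=
    ((((((kq_tendsto_kap hr0).const_sub kap).const_mul B0).const_sub Q).div_const kap).sub_const
      ε).const_mul _
  rw [sub_self, mul_zero, sub_zero] at hNl
  obtain ⟨N, hN1, hN⟩ := ((hNl.eventually (lt_mem_nhds hr1)).and (eventually_gt_atTop 0)).exists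
  set κ := ∫ u in (-r)..r, kq N u with hκ
  have hPx : Tendsto (fun x => Real.exp (-(2 * r)) *
      (((∫ z in Ioi x0, T z * kq N (z - (x + -r))) - B0 * (kap - κ)) / kap - ε)) atTop
      (nhds (Real.exp (-(2 * r)) * ((Q - B0 * (kap - κ)) / kap - ε))) :=
    (((((hP N hN).comp (tendsto_atTop_add_const_right _ (-r) tendsto_id)).sub_const _).div_const
      kap).sub_const ε).const_mul _
  filter_upwards [hPx.eventually (lt_mem_nhds hN1), eventually_ge_atTop (x0 + 2 * r),
    eventually_ge_atTop (x1 + 2 * r)] with y hy hy0 hy1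
  refine hy.trans_le ?_
  set w := y + -r with hw
  set P := ∫ z in Ioi x0, T z * kq N (z - w) with hPdef
  have hTy : 0 ≤ T y := hT0 y (by linarith)
  set A := Real.exp (2 * r) * T y + ε with hA
  have hA0 : 0 ≤ A := by positivity
  have iK := kq_shift_int hN w
  have iI : Integrable ((Ioc (w - r) (w + r)).indicator (fun z => kq N (z - w))) :=
    iK.indicator measurableSet_Ioc
  have iAll : Integrable (fun z => A * kq N (z - w) +
      B0 * (kq N (z - w) - (Ioc (w - r) (w + r)).indicator (fun z => kq N (z - w)) z)) :=
    (iK.const_mul A).add ((iK.sub iI).const_mul B0)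
  have hle : ∀ z, (Ioc (w - r) (w + r)).indicator (fun z => kq N (z - w)) z ≤ kq N (z - w) :=
    fun z => indicator_le_self' (fun z _ => kq_nonneg hN _) z
  have key : P ≤ A * kap + B0 * (kap - κ) := by
    calc P ≤ ∫ z in Ioi x0, (A * kq N (z - w) +
            B0 * (kq N (z - w) - (Ioc (w - r) (w + r)).indicator (fun z => kq N (z - w)) z)) := by
          apply setIntegral_mono_on (hint N hN _) iAll.integrableOn measurableSet_Ioi
          intro z hz
          have hz : x0 < z := hz
          have hq := kq_nonneg hN (z - w)
          by_cases hm : z ∈ Ioc (w - r) (w + r)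
          · rw [indicator_of_mem hm, sub_self, mul_zero, add_zero]
            apply mul_le_mul_of_nonneg_right _ hq
            have hz1 := hm.1
            have hz2 := hm.2
            have h1 := hs z y (by linarith) (by linarith) (by linarith)
            have h2 : Real.exp (y - z) * T y ≤ Real.exp (2 * r) * T y := by
              apply mul_le_mul_of_nonneg_right _ hTy
              apply Real.exp_le_exp.2
              linarith
            rw [hA]; linarith
          · rw [indicator_of_notMem hm, sub_zero]
            have h1 := mul_le_mul_of_nonneg_right (hTB z hz.le) hq
            have h2 := mul_nonneg hA0 hq
            linarith
      _ ≤ ∫ z, (A * kq N (z - w) +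
            B0 * (kq N (z - w) - (Ioc (w - r) (w + r)).indicator (fun z => kq N (z - w)) z)) := by
          apply setIntegral_le_integral iAll
          refine Eventually.of_forall fun z => ?_
          have h1 := mul_nonneg hA0 (kq_nonneg hN (z - w))
          have h2 := mul_nonneg hB0 (sub_nonneg.2 (hle z))
          simp only [Pi.zero_apply]
          linarith
      _ = A * kap + B0 * (kap - κ) := by
          have iS : Integrable (fun z => kq N (z - w) -
            (Ioc (w - r) (w + r)).indicator (fun z => kq N (z - w)) z) := iK.sub iI
          rw [integral_add (iK.const_mul A) (iS.const_mul B0), integral_const_mul,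
            integral_const_mul, integral_sub iK iI, integral_indicator measurableSet_Ioc,
            kq_window hr0, integral_sub_right_eq_self (kq N) w, kq_integral hN]
  rw [Real.exp_neg, inv_mul_le_iff₀ (Real.exp_pos _), sub_le_iff_le_add, div_le_iff₀ hk]
  linarith

lemma bdd_below {s : ℝ → ℝ} (hslow : ∀ ε, 0 < ε → ∃ h, 0 < h ∧ ∃ x1, ∀ x y, x1 ≤ x → x ≤ y →
      y ≤ x + h → s x - ε ≤ Real.exp (y - x) * s y) :
    ∃ M x0, 0 ≤ M ∧ 0 ≤ x0 ∧ ∀ x, x0 ≤ x → 0 ≤ s x + M := by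
  obtain ⟨h, hh, x1, hs⟩ := hslow 1 one_pos
  set x0 := max x1 0
  have hx01 : x1 ≤ x0 := le_max_left _ _
  set M := |s x0| + 1 + 1 / h with hM
  have hM0 : 0 ≤ M := by positivity
  refine ⟨M, x0, hM0, le_max_right _ _, ?_⟩
  have hMh : M + 1 ≤ M * Real.exp h := by
    have h1 := Real.add_one_le_exp h
    have h2 : 1 / h * h = 1 := by field_simp
    have h3 : 1 ≤ M * h := by
      have : 0 ≤ (|s x0| + 1) * h := by positivity
      rw [hM]; linarith
    nlinarith
  have hind : ∀ n : ℕ, ∀ x, x0 ≤ x → x ≤ x0 + (n + 1) * h → 0 ≤ s x + M := by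
    intro n
    induction n with
    | zero =>
      intro x hx hx2
      have h1 := hs x0 x hx01 hx (by simpa using hx2)
      by_contra hcon
      push Not at hcon
      have h2 : 1 ≤ Real.exp (x - x0) := Real.one_le_exp (by linarith)
      have h3 := neg_abs_le (s x0)
      have h4 : 0 < 1 / h := by positivity
      nlinarith
    | succ n ih =>
      intro x hx hx2
      by_cases hc : x ≤ x0 + (n + 1) * h
      · exact ih x hx hc
      push Not at hc
      push_cast at hx2
      have hn : (0:ℝ) ≤ n * h := by positivity
      have h1 := ih (x - h) (by linarith) (by linarith)
      have h2 := hs (x - h) x (by linarith) (by linarith) (by linarith)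
      rw [sub_sub_cancel] at h2
      by_contra hcon
      push Not at hcon
      have := Real.exp_pos h
      nlinarith
  intro x hx
  obtain ⟨n, hn⟩ := exists_nat_ge ((x - x0) / h)
  rw [div_le_iff₀ hh] at hn
  exact hind n x hx (by linarith)

lemma partB {s : ℝ → ℝ} (hW : IntegrableOn (fun x => s x * (1 + x ^ 2)⁻¹) (Ioi 0)) {c : ℝ}
    (hc : ∀ N, 0 < N → Tendsto (fun y => ∫ x in Ioi 0, s x * kq N (x - y)) atTop (nhds c))
    (hslow : ∀ ε, 0 < ε → ∃ h, 0 < h ∧ ∃ x1, ∀ x y, x1 ≤ x → x ≤ y →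
      y ≤ x + h → s x - ε ≤ Real.exp (y - x) * s y) :
    Tendsto s atTop (nhds (c / kap)) := by
  obtain ⟨M, x0, hM, hx0, hT0⟩ := bdd_below hslow
  have hk := kap_pos
  have hslow' : ∀ ε, 0 < ε → ∃ h, 0 < h ∧ ∃ x1, ∀ x y, x1 ≤ x → x ≤ y →
      y ≤ x + h → (s x + M) - ε ≤ Real.exp (y - x) * (s y + M) := by
    intro ε hε
    obtain ⟨h, hh, x1, hs⟩ := hslow ε hε
    refine ⟨h, hh, x1, fun x y h1 h2 h3 => ?_⟩
    have := hs x y h1 h2 h3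
    have h4 : 1 ≤ Real.exp (y - x) := Real.one_le_exp (by linarith)
    nlinarith
  have hQ : (c + M * kap) / kap = c / kap + M := by field_simp
  have hup := fun B hB => taub_upper (T := fun x => s x + M) (Q := c + M * kap) (x0 := x0) hT0
    (fun N hN y => sT_int hW hN M hx0 y) (fun N hN => sT_tendsto hW hN (hc N hN) M hx0) hslow'
    (B := B) hB
  obtain ⟨X, hX⟩ := eventually_atTop.1 (hup _ (lt_add_one _))
  have hx0' : 0 ≤ max x0 X := hx0.trans (le_max_left _ _)
  have hlo := fun B hB => taub_lower (T := fun x => s x + M) (Q := c + M * kap) (x0 := max x0 X)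
    (fun x hx => hT0 x ((le_max_left _ _).trans hx))
    (fun x hx => (hX x ((le_max_right _ _).trans hx)).le)
    (fun N hN y => sT_int hW hN M hx0' y) (fun N hN => sT_tendsto hW hN (hc N hN) M hx0') hslow'
    (B := B) hB
  rw [tendsto_order]
  constructor
  · intro a ha
    filter_upwards [hlo (a + M) (by rw [hQ]; linarith)] with x hx
    linarith
  · intro a ha
    filter_upwards [hup (a + M) (by rw [hQ]; linarith)] with x hx
    linarith

lemma laplace_re {S : ℝ → ℝ}
    (hW : IntegrableOn (fun x => (Real.exp (-x) * S x) * (1 + x ^ 2)⁻¹) (Ioi 0))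
    {σ : ℝ} (hσ : 1 < σ) (t : ℝ) :
    (laplaceT S (σ + t * Complex.I)).re = kV (fun x => Real.exp (-x) * S x) (σ - 1) t := by
  unfold laplaceT kV
  have hpt : ∀ x : ℝ, Complex.exp (-((σ:ℂ) + t * Complex.I) * x) * (S x : ℂ) =
      ((Real.exp (-x) * S x * Real.exp (-((σ - 1) * x)) : ℝ) : ℂ) *
        Complex.exp (((-(t * x) : ℝ) : ℂ) * Complex.I) := by
    intro x
    rw [show -((σ:ℂ) + t * Complex.I) * x = ((-x : ℝ) : ℂ) + ((-((σ - 1) * x) : ℝ) : ℂ)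
      + ((-(t * x) : ℝ) : ℂ) * Complex.I by push_cast; ring, Complex.exp_add, Complex.exp_add]
    push_cast
    ring
  simp_rw [hpt]
  have h1 : IntegrableOn (fun x => (Real.exp (-x) * S x) * Real.exp (-((σ - 1) * x))) (Ioi 0) := by
    refine s_mul_int hW (by fun_prop) (C := 1 + 2 / (σ - 1) ^ 2) ?_
    intro x hx
    rw [abs_of_pos (Real.exp_pos _)]
    exact exp_decay (by linarith) hx
  have h2 : Integrable (fun x : ℝ => ((Real.exp (-x) * S x * Real.exp (-((σ - 1) * x)) : ℝ) : ℂ) *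
        Complex.exp (((-(t * x) : ℝ) : ℂ) * Complex.I)) (volume.restrict (Ioi 0)) := by
    refine Integrable.mul_bdd (c := 1) h1.ofReal ?_ ?_
    · exact (by fun_prop : Continuous _).aestronglyMeasurable
    · exact Eventually.of_forall fun x => (Complex.norm_exp_ofReal_mul_I _).le
  rw [← RCLike.re_eq_complex_re, ← integral_re h2]
  congr 1
  ext x
  rw [RCLike.re_eq_complex_re, Complex.re_ofReal_mul, Complex.exp_ofReal_mul_I_re, Real.cos_neg]
  ring

/-- Koga's theorem (Theorem 1.1). -/
theorem koga_wiener_ikehara (S : ℝ → ℝ)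
    (hS : LocallyIntegrableOn S (Ici 0))
    (hslow : LogLinSlowlyDecreasing S)
    (hint : IntegrableOn (fun x : ℝ => |S x| / (x ^ 2 * Real.exp x)) (Ioi 1))
    (U : ℂ → ℝ) (hU : ∀ s : ℂ, U s = (laplaceT S s).re)
    (lam : ℝ) (hlam : 0 < lam)
    (g : ℝ → ℝ) (hg : IntegrableOn g (Ioo (-lam) lam))
    (hlow : ∀ σ ∈ Ioc (1 : ℝ) 2, ∀ᵐ t ∂(volume.restrict (Ioo (-lam) lam)),
      g t ≤ U (σ + t * Complex.I))
    (hbd : L1locBoundaryBehavior U) :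
    ∃ a : ℝ, Tendsto (fun x : ℝ => Real.exp (-x) * S x) atTop (nhds a) := by
  have hW : IntegrableOn (fun x => (Real.exp (-x) * S x) * (1 + x ^ 2)⁻¹) (Ioi 0) := by
    have hc : Continuous (fun x : ℝ => Real.exp (-x) * (1 + x ^ 2)⁻¹) := by
      have : Continuous (fun x : ℝ => (1 + x ^ 2)⁻¹) :=
        Continuous.inv₀ (by fun_prop) (fun x => by positivity)
      fun_prop
    have h1 : IntegrableOn (fun x => (Real.exp (-x) * S x) * (1 + x ^ 2)⁻¹) (Icc 0 1) := by
      have h0 : IntegrableOn S (Icc 0 1) :=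
        hS.integrableOn_compact_subset (fun x hx => hx.1) isCompact_Icc
      have := h0.mul_continuousOn hc.continuousOn isCompact_Icc
      refine this.congr (Eventually.of_forall fun x => ?_)
      simp only
      ring
    have h2 : IntegrableOn (fun x => (Real.exp (-x) * S x) * (1 + x ^ 2)⁻¹) (Ioi 1) := by
      have hm : AEStronglyMeasurable S (volume.restrict (Ioi 1)) :=
        hS.aestronglyMeasurable.mono_set (Ioi_subset_Ici_self.trans (Ici_subset_Ici.2 zero_le_one))
      have hm2 : AEStronglyMeasurable (fun x => (Real.exp (-x) * S x) * (1 + x ^ 2)⁻¹)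
          (volume.restrict (Ioi 1)) := by
        refine (hm.mul hc.aestronglyMeasurable).congr (Eventually.of_forall fun x => ?_)
        simp only [Pi.mul_apply]
        ring
      refine Integrable.mono' hint hm2 ?_
      filter_upwards [ae_restrict_mem measurableSet_Ioi] with x hx
      have hx0 : 0 < x := zero_lt_one.trans hx
      rw [Real.norm_eq_abs, abs_mul, abs_mul, abs_of_pos (Real.exp_pos _),
        abs_of_pos (by positivity : 0 < (1 + x ^ 2)⁻¹), Real.exp_neg]
      have h3 : (1 + x ^ 2)⁻¹ ≤ (x ^ 2)⁻¹ := by gcongr; linarith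
      calc (Real.exp x)⁻¹ * |S x| * (1 + x ^ 2)⁻¹ ≤ (Real.exp x)⁻¹ * |S x| * (x ^ 2)⁻¹ := by gcongr
        _ = _ := by field_simp
    refine (h1.union h2).mono_set ?_
    intro x hx
    by_cases h : x ≤ 1
    · exact Or.inl ⟨le_of_lt hx, h⟩
    · exact Or.inr (not_le.1 h)
  set s : ℝ → ℝ := fun x => Real.exp (-x) * S x with hs
  have hUV : ∀ σ t : ℝ, 1 < σ → U (σ + t * Complex.I) = kV s (σ - 1) t := fun σ t hσ => by
    rw [hU, laplace_re hW hσ]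
  have hsub : Ioo 0 lam ⊆ Ioo (-lam) lam := Ioo_subset_Ioo_left (by linarith)
  have hg' : IntegrableOn g (Ioc 0 lam) := by
    rw [integrableOn_Ioc_iff_integrableOn_Ioo]
    exact hg.mono_set hsub
  have hlow' : ∀ d ∈ Ioc (0 : ℝ) 1, ∀ᵐ t ∂(volume.restrict (Ioc 0 lam)), g t ≤ kV s d t := by
    intro d hd
    rw [← restrict_Ioo_eq_restrict_Ioc]
    have := ae_restrict_of_ae_restrict_of_subset hsub
      (hlow (d + 1) ⟨by linarith [hd.1], by linarith [hd.2]⟩)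
    filter_upwards [this] with t ht
    rw [hUV _ _ (by linarith [hd.1]), add_sub_cancel_right] at ht
    exact ht
  obtain ⟨f, hf⟩ := hbd
  have hf' : ∀ a b : ℝ, 0 < a → a ≤ b → IntegrableOn f (Icc a b) ∧
      Tendsto (fun d => ∫ t in a..b, |kV s d t - f t|) (nhdsWithin 0 (Ioi 0)) (nhds 0) := by
    intro a b ha hab
    obtain ⟨h1, h2⟩ := hf a b hab (fun h => absurd h.1 (not_le.2 ha))
    refine ⟨h1, ?_⟩
    have h3 : Tendsto (fun d : ℝ => d + 1) (nhdsWithin 0 (Ioi 0)) (nhdsWithin 1 (Ioi 1)) := by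
      apply tendsto_nhdsWithin_of_tendsto_nhds_of_eventually_within
      · have : Continuous (fun d : ℝ => d + 1) := by fun_prop
        have := (this.tendsto 0).mono_left (nhdsWithin_le_nhds (s := Ioi 0))
        simpa using this
      · filter_upwards [self_mem_nhdsWithin] with d hd
        have hd : 0 < d := hd
        simp only [mem_Ioi]; linarith
    refine (h2.comp h3).congr' ?_
    filter_upwards [self_mem_nhdsWithin] with d hd
    have hd : 0 < d := hd
    simp only [Function.comp_apply]
    congr 1
    ext t
    rw [hUV _ _ (by linarith), add_sub_cancel_right]
  obtain ⟨c, hc⟩ := partA hW hlam hg' hlow' hf'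
  refine ⟨c / kap, partB hW hc ?_⟩
  intro ε hε
  obtain ⟨h, hh, x0, hx0, hsl⟩ := hslow ε hε
  refine ⟨h, hh, x0, fun x y h1 h2 h3 => ?_⟩
  have h4 := hsl x y h1 h2 h3
  have e1 : Real.exp (y - x) * s y = S y / Real.exp x := by
    simp only [hs]
    rw [← mul_assoc, ← Real.exp_add, show y - x + -y = -x by ring, Real.exp_neg]
    field_simp
  have e2 : s x = S x / Real.exp x := by
    simp only [hs]
    rw [Real.exp_neg]
    field_simp
  change s x - ε ≤ Real.exp (y - x) * s y
  rw [e1, e2]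
  rw [sub_div] at h4
  linarith
end
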